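/- arXiv:2405.17700 — 3 statements merged into one kernel-verified Lean document; each statement's English description precedes it below -/
import Mathlib

section
/- Fix d ≥ 2 and let m = 8(⌈d · log₂ d⌉ + 1). Then no sequence of m points u^1, …, u^m ∈ ℝ^d with strictly positive entries is pseudo-shattered by the class H = {u ↦ M(u; w, p) : w ∈ Δ_{d−1}, p ∈ ℝ} of real-valued functions. Consequently the pseudo-dimension of this class is strictly less than 8(d log₂ d + 1). -/
/-- The weighted power mean `M(u; w, p)`. -/
noncomputable def pmean {d : ℕ} (u w : Fin d → ℝ) (p : ℝ) : ℝ :=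
  if p = 0 then ∏ i, u i ^ w i else (∑ i, w i * u i ^ p) ^ (1 / p)

/-- `w` belongs to the probability simplex `Δ_{d-1}`. -/
def inSimplex {d : ℕ} (w : Fin d → ℝ) : Prop :=
  (∀ i, 0 ≤ w i) ∧ ∑ i, w i = 1

/-- The sign function: `+1` if `t ≥ 0`, `-1` if `t < 0`. -/
noncomputable def sgn (t : ℝ) : ℝ := if 0 ≤ t then 1 else -1

open Finset in
lemma expsum_zeros {ι : Type*} [DecidableEq ι] (S : Finset ι) : ∀ (c s : ι → ℝ),
    (∃ p, ∑ i ∈ S, c i * Real.exp (p * s i) ≠ 0) →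
    ∃ Z : Finset ℝ, (∀ p, ∑ i ∈ S, c i * Real.exp (p * s i) = 0 → p ∈ Z) ∧ Z.card < S.card := by
  induction S using Finset.induction_on with
  | empty => rintro c s ⟨p, hp⟩; simp at hp
  | insert a S ha ih =>
    intro c s ⟨p₀, hp₀⟩
    set g : ℝ → ℝ := fun p => c a + ∑ i ∈ S, c i * Real.exp (p * (s i - s a)) with hg
    have hfg : ∀ p, ∑ i ∈ insert a S, c i * Real.exp (p * s i) = Real.exp (p * s a) * g p := by
      intro p
      rw [Finset.sum_insert ha, hg]
      simp only [mul_add, Finset.mul_sum]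
      congr 1
      · ring
      · refine Finset.sum_congr rfl fun i _ => ?_
        rw [mul_left_comm, ← Real.exp_add]; congr 2; ring
    have hzero : ∀ p, ∑ i ∈ insert a S, c i * Real.exp (p * s i) = 0 ↔ g p = 0 := by
      intro p; rw [hfg]; simp [Real.exp_ne_zero]
    simp only [hzero]
    have hg0 : g p₀ ≠ 0 := fun h => hp₀ ((hzero _).2 h)
    set g' : ℝ → ℝ := fun p => ∑ i ∈ S, (c i * (s i - s a)) * Real.exp (p * (s i - s a)) with hg'
    have hder : ∀ p, HasDerivAt g (g' p) p := by
      intro p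
      refine HasDerivAt.const_add _ (HasDerivAt.fun_sum fun i _ => ?_)
      have := (((hasDerivAt_id p).mul_const (s i - s a)).exp).const_mul (c i)
      have e : c i * (s i - s a) * Real.exp (p * (s i - s a)) =
          c i * (Real.exp (id p * (s i - s a)) * (1 * (s i - s a))) := by
        simp only [id]; ring
      rw [e]
      exact this
    by_cases h : ∃ p, g' p ≠ 0
    · obtain ⟨Z', hZ', hc⟩ := ih (fun i => c i * (s i - s a)) (fun i => s i - s a) h
      have key : ∀ F : Finset ℝ, (∀ p ∈ F, g p = 0) → F.card ≤ Z'.card + 1 := by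
        intro F hF
        refine Finset.card_le_of_interleaved fun x hx y hy hxy _ => ?_
        obtain ⟨z, hz, hz0⟩ := exists_hasDerivAt_eq_zero (f := g) (f' := g') hxy
          (fun p _ => (hder p).continuousAt.continuousWithinAt) (by rw [hF x hx, hF y hy])
          (fun p _ => hder p)
        exact ⟨z, hZ' z hz0, hz.1, hz.2⟩
      have hfin : {p | g p = 0}.Finite := by
        by_contra hinf
        obtain ⟨F, hF, hFc⟩ := Set.Infinite.exists_subset_card_eq hinf (Z'.card + 2)
        have := key F (fun p hp => hF hp)
        omega
      refine ⟨hfin.toFinset, fun p hp => by simpa using hp, ?_⟩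
      have := key hfin.toFinset (fun p hp => by simpa using hp)
      rw [Finset.card_insert_of_notMem ha]; omega
    · push Not at h
      refine ⟨∅, fun p hp => ?_, by simp [Finset.card_insert_of_notMem ha]⟩
      exfalso
      have := is_const_of_deriv_eq_zero (f := g) (fun p => (hder p).differentiableAt)
        (fun p => by rw [(hder p).deriv, h])  p p₀
      exact hg0 (this ▸ hp)
open Matrix

/-- positive feasibility of a finite vector system -/
def PosFeas {d : ℕ} {τ : Type*} (x : τ → Fin d → ℝ) : Prop := ∃ y : Fin d → ℝ, ∀ t, 0 < y ⬝ᵥ x t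

lemma not_posFeas_of_det {d : ℕ} {τ : Type*} (x : τ → Fin d → ℝ) (t₀ : τ) (B : Fin d → τ)
    (h0 : (Matrix.of fun k => x (B k)).det ≠ 0)
    (h1 : ∀ k, (Matrix.of fun k' => x (Function.update B k t₀ k')).det *
      (Matrix.of fun k => x (B k)).det ≤ 0) : ¬ PosFeas x := by
  rintro ⟨y, hy⟩
  set A : Matrix (Fin d) (Fin d) ℝ := Matrix.of fun k => x (B k) with hA
  have hup : ∀ k, (Matrix.of fun k' => x (Function.update B k t₀ k')) = A.updateRow k (x t₀) := by
    intro k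
    ext k' i
    by_cases h : k' = k
    · subst h; simp
    · simp [h, hA]
  simp only [hup] at h1
  have hc := Matrix.mulVec_cramer Aᵀ (x t₀)
  rw [det_transpose] at hc
  have hc2 : y ⬝ᵥ (Aᵀ *ᵥ (Aᵀ.cramer (x t₀))) = A.det * (y ⬝ᵥ x t₀) := by
    rw [hc, dotProduct_smul, smul_eq_mul]
  have hc3 : y ⬝ᵥ (Aᵀ *ᵥ (Aᵀ.cramer (x t₀))) =
      ∑ k, (A.updateRow k (x t₀)).det * (y ⬝ᵥ x (B k)) := by
    rw [dotProduct_mulVec, vecMul_transpose]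
    simp only [dotProduct, mulVec, cramer_transpose_apply]
    refine Finset.sum_congr rfl fun k _ => ?_
    rw [mul_comm]; congr 1
    exact Finset.sum_congr rfl fun i _ => by simp [hA, mul_comm]
  have e : A.det * (A.det * (y ⬝ᵥ x t₀)) = 
      ∑ k, ((A.updateRow k (x t₀)).det * A.det) * (y ⬝ᵥ x (B k)) := by
    rw [← hc2, hc3, Finset.mul_sum]
    exact Finset.sum_congr rfl fun k _ => by ring
  have l : 0 < A.det * (A.det * (y ⬝ᵥ x t₀)) := by
    rw [← mul_assoc]; exact mul_pos (mul_self_pos.2 h0) (hy _)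
  have r : ∑ k, ((A.updateRow k (x t₀)).det * A.det) * (y ⬝ᵥ x (B k)) ≤ 0 :=
    Finset.sum_nonpos fun k _ => mul_nonpos_of_nonpos_of_nonneg (h1 k) (hy _).le
  linarith

lemma exists_det_of_not_posFeas {d : ℕ} {τ : Type*} [Finite τ] (x : τ → Fin d → ℝ)
    (hx : Submodule.span ℝ (Set.range x) = ⊤) (hn : ¬ PosFeas x) :
    ∃ (t₀ : τ) (B : Fin d → τ), (Matrix.of fun k => x (B k)).det ≠ 0 ∧
    ∀ k, (Matrix.of fun k' => x (Function.update B k t₀ k')).det *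
      (Matrix.of fun k => x (B k)).det ≤ 0 := by
  classical
  have h0 : (0 : Fin d → ℝ) ∈ convexHull ℝ (Set.range x) := by
    by_contra h0
    obtain ⟨f, u, hu, hf⟩ := geometric_hahn_banach_point_closed (convex_convexHull ℝ (Set.range x))
      ((Set.finite_range x).isCompact_convexHull ℝ).isClosed h0
    apply hn
    refine ⟨fun i => f (Pi.single i 1), fun t => ?_⟩
    have h1 := hf _ (subset_convexHull ℝ _ (Set.mem_range_self t))
    rw [map_zero] at hu
    have h2 : f (x t) = (fun i => f (Pi.single i 1)) ⬝ᵥ x t := by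
      conv_lhs => rw [pi_eq_sum_univ' (x t)]
      simp only [map_sum, map_smul, dotProduct, smul_eq_mul]
      refine Finset.sum_congr rfl fun i _ => ?_
      rw [mul_comm]
    linarith
  obtain ⟨ι, _, z, w, hz, haff, hw, hw1, hwz⟩ := eq_pos_convex_span_of_mem_convexHull h0
  have : Nonempty ι := by
    by_contra h
    rw [not_nonempty_iff] at h
    simp at hw1
  obtain ⟨i₀⟩ := this
  have hidx : ∀ i, ∃ t, x t = z i := fun i => hz ⟨i, rfl⟩
  choose idx hidx using hidx
  have hli : LinearIndependent ℝ (fun i : {i // i ≠ i₀} => z i) := by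
    rw [Fintype.linearIndependent_iff]
    intro g hg
    -- extend g to an affine dependency
    set G : ι → ℝ := fun i => if h : i ≠ i₀ then g ⟨i, h⟩ else 0 with hG
    have hGz : ∑ i, G i • z i = 0 := by
      rw [Fintype.sum_eq_add_sum_subtype_ne _ i₀, ← hg]
      simp only [hG, ne_eq, not_true_eq_false, dite_false, zero_smul, zero_add]
      exact Finset.sum_congr rfl fun i _ => by simp [i.2]
    set s := ∑ i, G i
    have haff' := affineIndependent_iff.1 haff Finset.univ (fun i => G i - s * w i)
      (by simp [Finset.sum_sub_distrib, ← Finset.mul_sum, hw1, s])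
      (by simp [sub_smul, Finset.sum_sub_distrib, mul_smul, ← Finset.smul_sum, hwz, hGz])
    have hs : s = 0 := by
      have := haff' i₀ (Finset.mem_univ _)
      simp [hG] at this
      rcases this with h | h
      · exact h
      · exact absurd h (hw i₀).ne'
    intro i
    have := haff' i.1 (Finset.mem_univ _)
    simpa [hs, hG, i.2] using this
  have hls : LinearIndepOn ℝ x (Set.range fun i : {i // i ≠ i₀} => idx i) := by
    rw [linearIndepOn_range_iff]
    · convert hli using 2 with i
      exact hidx i
    · intro i j hij
      apply Subtype.ext
      apply haff.injective
      rw [← hidx, ← hidx]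
      exact congrArg x hij
  obtain ⟨b, -, hsb, hspan, hb⟩ := exists_linearIndepOn_extension hls (Set.subset_univ _)
  have hspan' : ⊤ ≤ Submodule.span ℝ (Set.range fun t : b => x t) := by
    rw [← hx, Submodule.span_le, ← Set.image_univ]
    have : (Set.range fun t : b => x t) = x '' b := by ext; simp
    rw [this]; exact hspan
  let bas := Module.Basis.mk hb hspan'
  have := Fintype.ofFinite b
  have hcard : Fintype.card b = d := by
    rw [← Module.finrank_eq_card_basis bas]; simp
  let e : Fin d ≃ b := (Fintype.equivFinOfCardEq hcard).symm
  set B : Fin d → τ := fun k => (e k : τ) with hB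
  have hκ : ∀ i : {i // i ≠ i₀}, ∃ k, B k = idx i := fun i =>
    ⟨e.symm ⟨idx i, hsb ⟨i, rfl⟩⟩, by simp [hB]⟩
  choose κ hκ using hκ
  refine ⟨idx i₀, B, ?_, ?_⟩
  · have : LinearIndependent ℝ (Matrix.of fun k => x (B k)).row := by
      exact LinearIndependent.comp hb e e.injective
    rw [Matrix.linearIndependent_rows_iff_isUnit, Matrix.isUnit_iff_isUnit_det] at this
    exact this.ne_zero
  · intro k
    set A : Matrix (Fin d) (Fin d) ℝ := Matrix.of fun k => x (B k) with hA
    have hup : (Matrix.of fun k' => x (Function.update B k (idx i₀) k')) =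
        A.updateRow k (x (idx i₀)) := by
      ext k' i
      by_cases h : k' = k
      · subst h; simp
      · simp [h, hA]
    set γ : Fin d → ℝ := fun k => ∑ i : {i // i ≠ i₀} with κ i = k, -(w i / w i₀) with hγ
    have hxt : x (idx i₀) = ∑ k, γ k • A k := by
      have e1 : ∑ k, γ k • A k = ∑ i : {i // i ≠ i₀}, -(w i / w i₀) • z i := by
        rw [← Finset.sum_fiberwise Finset.univ κ]
        refine Finset.sum_congr rfl fun k _ => ?_
        rw [hγ, Finset.sum_smul]
        refine Finset.sum_congr rfl fun i hi => ?_
        simp only [Finset.mem_filter, Finset.mem_univ, true_and] at hi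
        have : A k = z i := by
          rw [← hidx, ← hκ, hi]; rfl
        rw [this]
      rw [e1, hidx]
      rw [Fintype.sum_eq_add_sum_subtype_ne _ i₀] at hwz
      have h3 : w i₀ • z i₀ = -∑ i : {i // i ≠ i₀}, w i • z i := eq_neg_of_add_eq_zero_left hwz
      have h4 : z i₀ = (w i₀)⁻¹ • (w i₀ • z i₀) := by
        rw [smul_smul, inv_mul_cancel₀ (hw i₀).ne', one_smul]
      rw [h4, h3, smul_neg, Finset.smul_sum, ← Finset.sum_neg_distrib]
      refine Finset.sum_congr rfl fun i _ => ?_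
      rw [smul_smul, neg_smul]; congr 2; ring
    rw [hup, hxt, det_updateRow_sum, smul_eq_mul, mul_assoc]
    refine mul_nonpos_of_nonpos_of_nonneg ?_ (mul_self_nonneg _)
    exact Finset.sum_nonpos fun i _ => by
      have := div_pos (hw i) (hw i₀); linarith

/-- sign attached to a subset -/
noncomputable def eps {J : Type*} [DecidableEq J] (B : Finset J) (j : J) : ℝ := if j ∈ B then 1 else -1

/-- vector system: unsigned -/
def sysY {d : ℕ} {J : Type*} (a : J → Fin d → ℝ) : J ⊕ Fin d → Fin d → ℝ :=
  Sum.elim a (fun i => Pi.single i 1)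

/-- vector system: signed -/
noncomputable def sysX {d : ℕ} {J : Type*} [DecidableEq J] (a : J → Fin d → ℝ) (B : Finset J) :
    J ⊕ Fin d → Fin d → ℝ :=
  fun t => (Sum.elim (eps B) (fun _ => 1) t : ℝ) • sysY a t

lemma sysX_span {d : ℕ} {J : Type*} [DecidableEq J] (a : J → Fin d → ℝ) (B : Finset J) :
    Submodule.span ℝ (Set.range (sysX a B)) = ⊤ := by
  rw [eq_top_iff, ← (Pi.basisFun ℝ (Fin d)).span_eq]
  apply Submodule.span_mono
  rintro _ ⟨i, rfl⟩
  exact ⟨Sum.inr i, by simp [sysX, sysY]⟩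

lemma sysX_det {d : ℕ} {J : Type*} [DecidableEq J] (a : J → Fin d → ℝ) (B : Finset J)
    (s : Fin d → J ⊕ Fin d) : (Matrix.of fun k => sysX a B (s k)).det =
      (∏ k, (Sum.elim (eps B) (fun _ => 1) (s k) : ℝ)) * (Matrix.of fun k => sysY a (s k)).det := by
  rw [← Matrix.det_mul_column]
  rfl

lemma posFeas_transfer {d : ℕ} {J : Type*} [Finite J] [DecidableEq J] (a a' : J → Fin d → ℝ)
    (h : ∀ s : Fin d → J ⊕ Fin d, SignType.sign (Matrix.of fun k => sysY a (s k)).det =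
      SignType.sign (Matrix.of fun k => sysY a' (s k)).det) (B : Finset J)
    (hf : PosFeas (sysX a B)) : PosFeas (sysX a' B) := by
  by_contra hn
  obtain ⟨t₀, s, h0, h1⟩ := exists_det_of_not_posFeas _ (sysX_span a' B) hn
  have hs : ∀ s : Fin d → J ⊕ Fin d, SignType.sign (Matrix.of fun k => sysX a B (s k)).det =
      SignType.sign (Matrix.of fun k => sysX a' B (s k)).det := by
    intro s
    rw [sysX_det, sysX_det, sign_mul, sign_mul, h]
  refine not_posFeas_of_det _ t₀ s ?_ ?_ hf
  · rw [← sign_ne_zero, hs, sign_ne_zero]; exact h0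
  · intro k
    have := h1 k
    rw [← not_lt, ← sign_eq_one_iff, sign_mul] at this ⊢
    rwa [hs, hs]

lemma sum_choose_le (m n : ℕ) : ∑ k ∈ Finset.Iic n, m.choose k ≤ (m + 1) ^ n := by
  rw [add_pow]
  have : Finset.Iic n = Finset.range (n + 1) := by ext; simp
  rw [this]
  refine Finset.sum_le_sum fun k hk => ?_
  have hk' : k ≤ n := by simpa [Nat.lt_succ_iff] using hk
  have h1 : 1 ≤ n.choose k := Nat.choose_pos hk'
  have h2 := Nat.choose_le_pow m k
  simp
  nlinarith [Nat.zero_le (m^k)]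

open Classical in
lemma card_posFeas_le {d : ℕ} {J : Type*} [Fintype J] (a : J → Fin d → ℝ) :
    (Finset.univ.filter fun B : Finset J => PosFeas (sysX a B)).card ≤
      (Fintype.card J + 1) ^ d := by
  set 𝒜 := Finset.univ.filter fun B : Finset J => PosFeas (sysX a B) with h𝒜
  have hvc : 𝒜.vcDim ≤ d := by
    refine Finset.sup_le fun s hs => ?_
    rw [Finset.mem_shatterer] at hs
    by_contra hcard
    push Not at hcard
    have hdep : ¬ LinearIndependent ℝ (fun j : s => a j) := by
      intro hli
      have := hli.fintype_card_le_finrank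
      simp at this
      omega
    rw [Fintype.not_linearIndependent_iff] at hdep
    obtain ⟨g, hg, i₀, hi₀⟩ := hdep
    obtain ⟨B, hB, hBs⟩ := hs (t := s.filter fun j => ∃ h : j ∈ s, 0 < g ⟨j, h⟩)
      (Finset.filter_subset _ _)
    obtain ⟨y, hy⟩ := (Finset.mem_filter.1 hB).2
    have hmem : ∀ j : s, (j : J) ∈ B ↔ 0 < g j := by
      intro j
      have := Finset.ext_iff.1 hBs j
      simpa using this
    have hpos : ∀ j : s, 0 < eps B (j : J) * (y ⬝ᵥ a j) := by
      intro j
      have := hy (Sum.inl j)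
      simpa [sysX, sysY] using this
    have hz : ∑ j : s, g j * (y ⬝ᵥ a j) = 0 := by
      have := congrArg (fun v => y ⬝ᵥ v) hg
      simpa [dotProduct_sum, dotProduct_smul] using this
    have hnn : ∀ j : s, 0 ≤ g j * (y ⬝ᵥ a j) := by
      intro j
      have h1 := hpos j
      unfold eps at h1
      split_ifs at h1 with h
      · have := (hmem j).1 h
        nlinarith
      · have := not_lt.1 (fun h' => h ((hmem j).2 h'))
        nlinarith
    have := (Finset.sum_eq_zero_iff_of_nonneg (fun j _ => hnn j)).1 hz i₀ (Finset.mem_univ _)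
    rcases mul_eq_zero.1 this with h | h
    · exact hi₀ h
    · have := hpos i₀; rw [h] at this; simp at this
  calc 𝒜.card ≤ 𝒜.shatterer.card := Finset.card_le_card_shatterer _
    _ ≤ ∑ k ∈ Finset.Iic 𝒜.vcDim, (Fintype.card J).choose k := Finset.card_shatterer_le_sum_vcDim
    _ ≤ (Fintype.card J + 1) ^ 𝒜.vcDim := sum_choose_le _ _
    _ ≤ _ := Nat.pow_le_pow_right (by omega) hvc

/-- the normalised power function -/
noncomputable def phi (p c : ℝ) : ℝ := if p = 0 then c else (Real.exp (p * c) - 1) / p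

lemma det_zeros {d : ℕ} {J : Type*} (c : J → Fin d → ℝ) (s : Fin d → J ⊕ Fin d) :
    ∃ Z : Finset ℝ, Z.card ≤ d.factorial * 2 ^ d ∧
      ((∀ p ≠ 0, (Matrix.of fun k => sysY (fun j i => phi p (c j i)) (s k)).det = 0) ∨
       (∀ p ≠ 0, (Matrix.of fun k => sysY (fun j i => phi p (c j i)) (s k)).det = 0 → p ∈ Z)) := by
  classical
  let al : Fin d → ℝ := fun k => Sum.elim (fun _ => 1) (fun _ => 0) (s k)
  let ga : Fin d → Fin d → ℝ := fun k i => Sum.elim (fun j => c j i) (fun _ => 0) (s k)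
  let be : Fin d → Fin d → ℝ := fun k i =>
    Sum.elim (fun _ => -1) (fun i' => (Pi.single i' 1 : Fin d → ℝ) i) (s k)
  let et : ℝ → Fin d → ℝ := fun p k => Sum.elim (fun _ => p⁻¹) (fun _ => 1) (s k)
  let co : Equiv.Perm (Fin d) × Finset (Fin d) → ℝ := fun q =>
    ((Equiv.Perm.sign q.1 : ℤ) : ℝ) * ((∏ k ∈ q.2, al (q.1 k)) * ∏ k ∈ Finset.univ \ q.2, be (q.1 k) k)
  let ex : Equiv.Perm (Fin d) × Finset (Fin d) → ℝ := fun q => ∑ k ∈ q.2, ga (q.1 k) k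
  have hdet : ∀ p ≠ 0, (Matrix.of fun k => sysY (fun j i => phi p (c j i)) (s k)).det =
      (∏ k, et p k) * ∑ q, co q * Real.exp (p * ex q) := by
    intro p hp
    have e1 : (Matrix.of fun k => sysY (fun j i => phi p (c j i)) (s k)) =
        Matrix.of fun k i => et p k * (Matrix.of fun k i => al k * Real.exp (p * ga k i) + be k i) k i := by
      ext k i
      simp only [Matrix.of_apply, sysY, et, al, ga, be]
      rcases s k with j | i'
      · simp [phi, hp]; ring
      · simp
    rw [e1, Matrix.det_mul_column, Matrix.det_apply']
    congr 1
    rw [Fintype.sum_prod_type]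
    refine Finset.sum_congr rfl fun σ _ => ?_
    simp only [Matrix.of_apply]
    rw [Finset.prod_add, Finset.mul_sum, Finset.powerset_univ]
    refine Finset.sum_congr rfl fun T _ => ?_
    simp only [co, ex]
    rw [Finset.prod_mul_distrib, Finset.mul_sum, Real.exp_sum]
    ring
  have het : ∀ p ≠ 0, ∏ k, et p k ≠ 0 := by
    intro p hp
    refine Finset.prod_ne_zero_iff.2 fun k _ => ?_
    simp only [et]
    rcases s k with j | i' <;> simp [hp]
  by_cases h : ∃ p, ∑ q, co q * Real.exp (p * ex q) ≠ 0
  · obtain ⟨Z, hZ, hc⟩ := expsum_zeros Finset.univ co ex h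
    refine ⟨Z, ?_, Or.inr fun p hp h0 => hZ p ?_⟩
    · refine hc.le.trans ?_
      simp [Fintype.card_perm]
    · rw [hdet p hp] at h0
      exact (mul_eq_zero.1 h0).resolve_left (het p hp)
  · push Not at h
    exact ⟨∅, by simp, Or.inl fun p hp => by rw [hdet p hp, h, mul_zero]⟩

lemma exists_crit {d : ℕ} {J : Type*} [Fintype J] (c : J → Fin d → ℝ) :
    ∃ Z : Finset ℝ, Z.card ≤ (Fintype.card J + d) ^ d * (d.factorial * 2 ^ d) + 1 ∧
      ∀ p q : ℝ, p < q → (∀ z ∈ Z, z ∉ Set.Icc p q) → ∀ s : Fin d → J ⊕ Fin d,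
        SignType.sign (Matrix.of fun k => sysY (fun j i => phi p (c j i)) (s k)).det =
        SignType.sign (Matrix.of fun k => sysY (fun j i => phi q (c j i)) (s k)).det := by
  classical
  choose Zs hc hZ using det_zeros (J := J) c
  refine ⟨insert 0 (Finset.univ.biUnion Zs), ?_, ?_⟩
  · refine (Finset.card_insert_le _ _).trans (Nat.add_le_add_right ?_ 1)
    refine (Finset.card_biUnion_le_card_mul _ _ _ (fun s _ => hc s)).trans ?_
    simp
  · intro p q hpq hno s
    have h0 : (0:ℝ) ∉ Set.Icc p q := hno 0 (by simp)
    have hne : ∀ t ∈ Set.Icc p q, t ≠ 0 := fun t ht h => h0 (h ▸ ht)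
    have hp : p ∈ Set.Icc p q := ⟨le_rfl, hpq.le⟩
    have hq : q ∈ Set.Icc p q := ⟨hpq.le, le_rfl⟩
    rcases hZ s with h | h
    · rw [h p (hne p hp), h q (hne q hq)]
    · set D : ℝ → ℝ := fun p => (Matrix.of fun k => sysY (fun j i => phi p (c j i)) (s k)).det with hD
      have hnz : ∀ t ∈ Set.Icc p q, D t ≠ 0 := by
        intro t ht h'
        exact hno t (by simp only [Finset.mem_insert, Finset.mem_biUnion]; right; exact ⟨s, by simp, h t (hne t ht) h'⟩) ht
      have hcont : ContinuousOn D (Set.Icc p q) := by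
        have hphi : ∀ x : ℝ, ContinuousOn (fun p => phi p x) (Set.Icc p q) := by
          intro x
          have : ContinuousOn (fun p : ℝ => (Real.exp (p * x) - 1) / p) (Set.Icc p q) :=
            ContinuousOn.div (by fun_prop) (by fun_prop) hne
          exact this.congr fun t ht => by simp [phi, hne t ht]
        simp only [hD, Matrix.det_apply]
        refine continuousOn_finsetSum _ fun σ _ => ContinuousOn.const_smul ?_ _
        refine continuousOn_finsetProd _ fun k _ => ?_
        simp only [Matrix.of_apply, sysY]
        rcases s (σ k) with j | i
        · exact hphi _
        · exact continuousOn_const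
      show SignType.sign (D p) = SignType.sign (D q)
      rcases lt_or_gt_of_ne (hnz p hp) with h1 | h1 <;> rcases lt_or_gt_of_ne (hnz q hq) with h2 | h2
      · rw [sign_neg h1, sign_neg h2]
      · obtain ⟨t, ht, h3⟩ := intermediate_value_Icc hpq.le hcont ⟨h1.le, h2.le⟩
        exact absurd h3 (hnz t ht)
      · obtain ⟨t, ht, h3⟩ := intermediate_value_Icc' hpq.le hcont ⟨h2.le, h1.le⟩
        exact absurd h3 (hnz t ht)
      · rw [sign_pos h1, sign_pos h2]

lemma posFeas_card {d : ℕ} {J : Type*} [Fintype J] [DecidableEq J] (c : J → Fin d → ℝ)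
    (hall : ∀ B : Finset J, ∃ p, PosFeas (sysX (fun j i => phi p (c j i)) B)) :
    2 ^ Fintype.card J ≤ (2 * ((Fintype.card J + d) ^ d * (d.factorial * 2 ^ d)) + 3) *
      (Fintype.card J + 1) ^ d := by
  classical
  obtain ⟨Z, hZc, hZ⟩ := exists_crit c
  let N : ℝ → ℕ := fun p => (Z.filter (· < p)).card + (Z.filter (· ≤ p)).card
  have hN : ∀ p, N p < 2 * Z.card + 1 := by
    intro p
    have h1 := Finset.card_filter_le Z (· < p)
    have h2 := Finset.card_filter_le Z (· ≤ p)
    simp only [N]; omega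
  have key : ∀ p q : ℝ, p < q → N p = N q → ∀ z ∈ Z, z ∉ Set.Icc p q := by
    intro p q hpq hNe z hz ⟨hz1, hz2⟩
    have s1 : Z.filter (· < p) ⊆ Z.filter (· < q) := fun x hx => by
      simp only [Finset.mem_filter] at hx ⊢; exact ⟨hx.1, hx.2.trans hpq⟩
    have s2 : Z.filter (· ≤ p) ⊆ Z.filter (· ≤ q) := fun x hx => by
      simp only [Finset.mem_filter] at hx ⊢; exact ⟨hx.1, hx.2.trans hpq.le⟩
    have c1 := Finset.card_le_card s1
    have c2 := Finset.card_le_card s2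
    simp only [N] at hNe
    have e1 := Finset.eq_of_subset_of_card_le s1 (by omega)
    have e2 := Finset.eq_of_subset_of_card_le s2 (by omega)
    rcases hz2.lt_or_eq with h | h
    · have : z ∈ Z.filter (· < q) := by simp [hz, h]
      rw [← e1] at this
      simp only [Finset.mem_filter] at this
      linarith [this.2]
    · have : z ∈ Z.filter (· ≤ q) := by simp [hz, h.le]
      rw [← e2] at this
      simp only [Finset.mem_filter] at this
      linarith [this.2]
  have htr : ∀ p q : ℝ, N p = N q → ∀ B, PosFeas (sysX (fun j i => phi p (c j i)) B) →
      PosFeas (sysX (fun j i => phi q (c j i)) B) := by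
    intro p q hNe B hB
    rcases lt_trichotomy p q with h | h | h
    · exact posFeas_transfer _ _ (hZ p q h (key p q h hNe)) B hB
    · rwa [← h]
    · exact posFeas_transfer _ _ (fun s => (hZ q p h (key q p h hNe.symm) s).symm) B hB
  choose P hP using hall
  have hfib := Finset.card_le_mul_card_image_of_maps_to (s := (Finset.univ : Finset (Finset J)))
    (t := Finset.range (2 * Z.card + 1)) (f := fun B => N (P B))
    (fun B _ => Finset.mem_range.2 (hN _)) ((Fintype.card J + 1) ^ d) (by
      intro n _
      rcases (Finset.univ.filter fun B => N (P B) = n).eq_empty_or_nonempty with h | ⟨B₀, hB₀⟩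
      · rw [h]; simp
      · refine le_trans (Finset.card_le_card ?_) (card_posFeas_le (fun j i => phi (P B₀) (c j i)))
        intro B hB
        simp only [Finset.mem_filter, Finset.mem_univ, true_and] at hB hB₀ ⊢
        have := htr _ _ (hB.trans hB₀.symm) B (hP B)
        convert this)
  rw [Finset.card_univ, Fintype.card_finset, Finset.card_range] at hfib
  refine hfib.trans ?_
  rw [mul_comm]
  exact Nat.mul_le_mul_right _ (by omega)

lemma fact_two_pow (d : ℕ) (hd : 1 ≤ d) : d.factorial * 2 ^ d ≤ 2 * d ^ d := by
  induction d, hd using Nat.le_induction with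
  | base => simp
  | succ n hn ih =>
    have hb : 2 * n ^ n ≤ (n + 1) ^ n := by
      obtain ⟨k, rfl⟩ : ∃ k, n = k + 1 := ⟨n - 1, by omega⟩
      rw [add_pow (k + 1) 1 (k + 1), Finset.sum_range_succ, Finset.sum_range_succ]
      simp only [one_pow, mul_one, Nat.choose_self, Nat.cast_one]
      have : (k+1).choose k = k + 1 := by simp
      simp only [Nat.cast_id, this]
      rw [← pow_succ]
      omega
    calc (n+1).factorial * 2 ^ (n+1) = 2 * (n+1) * (n.factorial * 2 ^ n) := by
          rw [Nat.factorial_succ, pow_succ]; ring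
      _ ≤ 2 * (n+1) * (2 * n ^ n) := Nat.mul_le_mul_left _ ih
      _ ≤ 2 * (n+1) * (n+1) ^ n := Nat.mul_le_mul_left _ hb
      _ = _ := by rw [pow_succ]; ring

lemma numeric (d c : ℕ) (hd : 2 ≤ d) (h1 : d ^ d ≤ 2 ^ c) (h2 : c ≤ d * (d - 1)) :
    (2 * ((8 * (c + 1) + d) ^ d * (d.factorial * 2 ^ d)) + 3) * (8 * (c + 1) + 1) ^ d
      < 2 ^ (8 * (c + 1)) := by
  rcases (by omega : d = 2 ∨ d = 3 ∨ 4 ≤ d) with rfl | rfl | h4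
  · have : 2 ≤ c := by
      by_contra h
      have := Nat.pow_le_pow_right (n := 2) (by norm_num) (show c ≤ 1 by omega)
      omega
    have : c = 2 := by omega
    subst this
    norm_num [Nat.factorial]
  · have : 5 ≤ c := by
      by_contra h
      have := Nat.pow_le_pow_right (n := 2) (by norm_num) (show c ≤ 4 by omega)
      omega
    have : c = 5 ∨ c = 6 := by omega
    rcases this with rfl | rfl <;> norm_num [Nat.factorial]
  · obtain ⟨e, rfl⟩ : ∃ e, d = e + 4 := ⟨d - 4, by omega⟩
    simp only [show e + 4 - 1 = e + 3 by omega] at h2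
    set d := e + 4 with hd'
    have hA : 8 * (c + 1) + d ≤ 8 * d ^ 2 := by nlinarith
    have hB : 8 * (c + 1) + 1 ≤ 8 * d ^ 2 := by nlinarith
    have h3 : 8 * d ^ 2 * (8 * d ^ 2) ≤ d ^ 7 := by
      have : 4 ^ 3 ≤ d ^ 3 := Nat.pow_le_pow_left h4 3
      calc 8 * d ^ 2 * (8 * d ^ 2) = 4 ^ 3 * d ^ 4 := by ring
        _ ≤ d ^ 3 * d ^ 4 := Nat.mul_le_mul_right _ this
        _ = _ := by ring
    have hf := fact_two_pow d (by omega)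
    set K := (8 * (c + 1) + d) ^ d * (d.factorial * 2 ^ d) with hK
    have hK1 : 1 ≤ K := Nat.mul_pos (by positivity) (by positivity)
    have hdd : 0 < d ^ d := by positivity
    calc (2 * K + 3) * (8 * (c + 1) + 1) ^ d ≤ (5 * K) * (8 * (c + 1) + 1) ^ d :=
          Nat.mul_le_mul_right _ (by omega)
      _ ≤ (5 * ((8 * d ^ 2) ^ d * (2 * d ^ d))) * (8 * d ^ 2) ^ d := by
          rw [hK]; gcongr
      _ = 10 * ((8 * d ^ 2 * (8 * d ^ 2)) ^ d * d ^ d) := by rw [mul_pow (8 * d^2)]; ring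
      _ ≤ 10 * ((d ^ 7) ^ d * d ^ d) := by gcongr
      _ = 10 * (d ^ d) ^ 8 := by rw [← mul_pow, ← pow_mul, ← pow_succ, ← pow_mul]; ring_nf
      _ < 2 ^ 8 * (d ^ d) ^ 8 := by
          apply Nat.mul_lt_mul_of_pos_right (by norm_num) (by positivity)
      _ ≤ 2 ^ 8 * (2 ^ c) ^ 8 := by gcongr
      _ = _ := by rw [← pow_mul, ← pow_add]; ring_nf

lemma ceil_facts (d : ℕ) (hd : 2 ≤ d) :
    d ^ d ≤ 2 ^ ⌈(d : ℝ) * Real.logb 2 d⌉₊ ∧ ⌈(d : ℝ) * Real.logb 2 d⌉₊ ≤ d * (d - 1) := by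
  have hd0 : (0:ℝ) < d := by positivity
  constructor
  · have h := Nat.le_ceil ((d : ℝ) * Real.logb 2 d)
    have h2 : ((d:ℝ) ^ d) = (2:ℝ) ^ ((d : ℝ) * Real.logb 2 d) := by
      rw [mul_comm, Real.rpow_mul (by norm_num), Real.rpow_logb (by norm_num) (by norm_num) hd0,
        Real.rpow_natCast]
    have h3 : ((d:ℝ) ^ d) ≤ (2:ℝ) ^ (⌈(d : ℝ) * Real.logb 2 d⌉₊ : ℝ) := by
      rw [h2]; exact Real.rpow_le_rpow_of_exponent_le (by norm_num) h
    rw [Real.rpow_natCast] at h3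
    exact_mod_cast h3
  · rw [Nat.ceil_le]
    push_cast
    refine mul_le_mul_of_nonneg_left ?_ hd0.le
    rw [Real.logb_le_iff_le_rpow (by norm_num) hd0, Real.rpow_natCast]
    have : d ≤ 2 ^ (d - 1) := by
      have := Nat.lt_two_pow_self (n := d - 1)
      omega
    exact_mod_cast this

lemma wsum_pos {d : ℕ} (w v : Fin d → ℝ) (hw : inSimplex w) (hv : ∀ i, 0 < v i) :
    0 < ∑ i, w i * v i := by
  have hne : ∃ i, 0 < w i := by
    by_contra h
    push Not at h
    have : ∑ i, w i ≤ 0 := Finset.sum_nonpos fun i _ => h i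
    linarith [hw.2]
  obtain ⟨i, hi⟩ := hne
  exact Finset.sum_pos' (fun i _ => mul_nonneg (hw.1 i) (hv i).le)
    ⟨i, Finset.mem_univ _, mul_pos hi (hv i)⟩

lemma pmean_pos {d : ℕ} (u w : Fin d → ℝ) (p : ℝ) (hu : ∀ i, 0 < u i) (hw : inSimplex w) :
    0 < pmean u w p := by
  unfold pmean
  split_ifs with h
  · exact Finset.prod_pos fun i _ => Real.rpow_pos_of_pos (hu i) _
  · exact Real.rpow_pos_of_pos (wsum_pos w _ hw fun i => Real.rpow_pos_of_pos (hu i) _) _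

lemma pmean_sign {d : ℕ} (u w : Fin d → ℝ) (p r : ℝ) (hu : ∀ i, 0 < u i) (hr : 0 < r)
    (hw : inSimplex w) :
    (r < pmean u w p → 0 < ∑ i, w i * phi p (Real.log (u i) - Real.log r)) ∧
    (pmean u w p < r → ∑ i, w i * phi p (Real.log (u i) - Real.log r) < 0) := by
  have hM := pmean_pos u w p hu hw
  rw [← Real.log_lt_log_iff hr hM, ← Real.log_lt_log_iff hM hr]
  by_cases hp : p = 0
  · have e1 : Real.log (pmean u w p) = ∑ i, w i * Real.log (u i) := by
      rw [pmean, if_pos hp, Real.log_prod (fun i _ => (Real.rpow_pos_of_pos (hu i) _).ne')]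
      exact Finset.sum_congr rfl fun i _ => Real.log_rpow (hu i) _
    have e2 : ∑ i, w i * phi p (Real.log (u i) - Real.log r) =
        Real.log (pmean u w p) - Real.log r := by
      rw [e1]
      simp only [phi, if_pos hp, mul_sub, Finset.sum_sub_distrib, ← Finset.sum_mul, hw.2, one_mul]
    rw [e2]
    constructor <;> intro h <;> linarith
  · set Y := ∑ i, w i * Real.exp (p * (Real.log (u i) - Real.log r)) with hY
    have hYpos : 0 < Y := wsum_pos w _ hw fun i => Real.exp_pos _
    have e2 : ∑ i, w i * phi p (Real.log (u i) - Real.log r) = (Y - 1) / p := by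
      have h1 : Y - 1 = ∑ i, w i * (Real.exp (p * (Real.log (u i) - Real.log r)) - 1) := by
        simp only [mul_sub, Finset.sum_sub_distrib, mul_one, hw.2, hY]
      rw [h1, Finset.sum_div]
      exact Finset.sum_congr rfl fun i _ => by rw [phi, if_neg hp, mul_div_assoc]
    have e3 : ∑ i, w i * u i ^ p = Y * Real.exp (p * Real.log r) := by
      rw [hY, Finset.sum_mul]
      refine Finset.sum_congr rfl fun i _ => ?_
      rw [mul_assoc, ← Real.exp_add, Real.rpow_def_of_pos (hu i)]
      congr 2; ring
    have e1 : Real.log (pmean u w p) = Real.log Y / p + Real.log r := by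
      rw [pmean, if_neg hp, Real.log_rpow (wsum_pos w _ hw fun i => Real.rpow_pos_of_pos (hu i) _),
        e3, Real.log_mul hYpos.ne' (Real.exp_ne_zero _), Real.log_exp]
      field_simp
    rw [e1, e2]
    constructor
    · intro h
      have h' : 0 < Real.log Y / p := by linarith
      rcases lt_or_gt_of_ne hp with hp' | hp'
      · have : Real.log Y < 0 := by
          by_contra hc
          exact absurd h' (not_lt.2 (div_nonpos_of_nonneg_of_nonpos (not_lt.1 hc) hp'.le))
        have := (Real.log_neg_iff hYpos).1 this
        exact div_pos_of_neg_of_neg (by linarith) hp'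
      · have : 0 < Real.log Y := by
          by_contra hc
          exact absurd h' (not_lt.2 (div_nonpos_of_nonpos_of_nonneg (not_lt.1 hc) hp'.le))
        have := (Real.log_pos_iff hYpos.le).1 this
        exact div_pos (by linarith) hp'
    · intro h
      have h' : Real.log Y / p < 0 := by linarith
      rcases lt_or_gt_of_ne hp with hp' | hp'
      · have : 0 < Real.log Y := by
          by_contra hc
          exact absurd h' (not_lt.2 (div_nonneg_of_nonpos (not_lt.1 hc) hp'.le))
        have := (Real.log_pos_iff hYpos.le).1 this
        exact div_neg_of_pos_of_neg (by linarith) hp'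
      · have : Real.log Y < 0 := by
          by_contra hc
          exact absurd h' (not_lt.2 (div_nonneg (not_lt.1 hc) hp'.le))
        have := (Real.log_neg_iff hYpos).1 this
        exact div_neg_of_neg_of_pos (by linarith) hp'

open Filter Topology in
lemma posFeas_of_weak {d : ℕ} {J : Type*} [Finite J] [DecidableEq J] (a : J → Fin d → ℝ)
    (B : Finset J) (w : Fin d → ℝ) (hw : ∀ i, 0 ≤ w i)
    (h : ∀ j, 0 < eps B j * ∑ i, w i * a j i) : PosFeas (sysX a B) := by
  have h1 : ∀ᶠ δ : ℝ in 𝓝[>] 0, ∀ j, 0 < eps B j * ∑ i, (w i + δ) * a j i := by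
    rw [eventually_all]
    intro j
    have hc : Continuous fun δ : ℝ => eps B j * ∑ i, (w i + δ) * a j i := by fun_prop
    have ht := (hc.tendsto 0).eventually (lt_mem_nhds (a := 0) (by simpa using h j))
    exact ht.filter_mono nhdsWithin_le_nhds
  obtain ⟨δ, hδ, hδ0⟩ := (h1.and self_mem_nhdsWithin).exists
  refine ⟨fun i => w i + δ, ?_⟩
  rintro (j | i)
  · change 0 < (fun i => w i + δ) ⬝ᵥ (eps B j • a j)
    rw [dotProduct_smul]
    exact hδ j
  · have : 0 < w i + δ := add_pos_of_nonneg_of_pos (hw i) hδ0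
    simpa [sysX, sysY] using this

open Filter Topology in
lemma not_shattered {d m : ℕ} (hm : (2 * ((m + d) ^ d * (d.factorial * 2 ^ d)) + 3) * (m + 1) ^ d
      < 2 ^ m) (u : Fin m → Fin d → ℝ) (hu : ∀ j i, 0 < u j i) (r : Fin m → ℝ) :
    ∃ b : Fin m → ℝ, (∀ j, b j = 1 ∨ b j = -1) ∧
          ¬ ∃ (w : Fin d → ℝ) (p : ℝ), inSimplex w ∧
              ∀ j, sgn (pmean (u j) w p - r j) = b j := by
  by_contra hcon
  push Not at hcon
  have hall : ∀ B : Finset (Fin m), ∃ (w : Fin d → ℝ) (p : ℝ), inSimplex w ∧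
      ∀ j, sgn (pmean (u j) w p - r j) = eps B j := fun B => hcon (eps B) (fun j => by
        unfold eps; split_ifs <;> simp)
  choose W P hW hS using hall
  have hmem : ∀ B j, j ∈ B → r j ≤ pmean (u j) (W B) (P B) := by
    intro B j hj
    have := hS B j
    simp only [eps, if_pos hj, sgn] at this
    split_ifs at this with h
    · linarith
    · norm_num at this
  have hnot : ∀ B j, j ∉ B → pmean (u j) (W B) (P B) < r j := by
    intro B j hj
    have := hS B j
    simp only [eps, if_neg hj, sgn] at this
    split_ifs at this with h
    · norm_num at this
    · linarith
  have hr' : ∀ j, ∃ r', 0 < r' ∧ r' < r j ∧ ∀ B, j ∉ B → pmean (u j) (W B) (P B) < r' := by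
    intro j
    have hrj : 0 < r j := (pmean_pos (u j) (W ∅) (P ∅) (hu j) (hW ∅)).trans (hnot ∅ j (by simp))
    have h1 : ∀ᶠ t in 𝓝[<] (r j), 0 < t := (lt_mem_nhds hrj).filter_mono nhdsWithin_le_nhds
    have h2 : ∀ᶠ t in 𝓝[<] (r j), ∀ B, j ∉ B → pmean (u j) (W B) (P B) < t := by
      rw [eventually_all]
      intro B
      by_cases hj : j ∈ B
      · exact Eventually.of_forall fun t h => absurd hj h
      · have := (lt_mem_nhds (hnot B j hj)).filter_mono (nhdsWithin_le_nhds (s := Set.Iio (r j)))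
        filter_upwards [this] with t ht _ using ht
    obtain ⟨t, ⟨ha, hb⟩, hc⟩ := ((h1.and h2).and self_mem_nhdsWithin).exists
    exact ⟨t, ha, hc, hb⟩
  choose r' hr0 hrr hrB using hr'
  have hfin := posFeas_card (fun j i => Real.log (u j i) - Real.log (r' j)) (fun B => ⟨P B, by
    refine posFeas_of_weak _ B (W B) (hW B).1 fun j => ?_
    have hs := pmean_sign (u j) (W B) (P B) (r' j) (hu j) (hr0 j) (hW B)
    by_cases hj : j ∈ B
    · have := hs.1 ((hrr j).trans_le (hmem B j hj))
      simpa [eps, hj] using this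
    · have := hs.2 (hrB j B hj)
      simpa [eps, hj] using this⟩)
  rw [Fintype.card_fin] at hfin
  omega

/-- No sequence of `m = 8(⌈d·log₂ d⌉ + 1)` positive points is pseudo-shattered by
the class `{u ↦ M(u; w, p) : w ∈ Δ_{d-1}, p ∈ ℝ}`; hence its pseudo-dimension is
less than `8(d log₂ d + 1)`. -/
theorem pdim_unknown_weights (d : ℕ) (hd : 2 ≤ d) :
    ∀ u : Fin (8 * (⌈(d : ℝ) * Real.logb 2 d⌉₊ + 1)) → Fin d → ℝ,
      (∀ j i, 0 < u j i) →
      ∀ r : Fin (8 * (⌈(d : ℝ) * Real.logb 2 d⌉₊ + 1)) → ℝ,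
        ∃ b : Fin (8 * (⌈(d : ℝ) * Real.logb 2 d⌉₊ + 1)) → ℝ,
          (∀ j, b j = 1 ∨ b j = -1) ∧
          ¬ ∃ (w : Fin d → ℝ) (p : ℝ), inSimplex w ∧
              ∀ j, sgn (pmean (u j) w p - r j) = b j := by
  intro u hu r
  obtain ⟨h1, h2⟩ := ceil_facts d hd
  exact not_shattered (numeric d _ hd h1 h2) u hu r
end

section
/- Fix d ≥ 2, a weight vector w ∈ Δ_{d−1}, and let m = 2(⌈log₂ d⌉ + 1). Then no sequence of m pairs (u^1, v^1), …, (u^m, v^m) of vectors in ℝ^d with strictly positive entries is shattered by the comparison class C_{w,d} = {(u, v) ↦ C((u, v); w, p) : p ∈ ℝ}: there exists a sign pattern b ∈ {−1, +1}^m such that no p ∈ ℝ satisfies C((u^j, v^j); w, p) = b_j for all j = 1, …, m. Consequently the VC dimension of C_{w,d} is strictly less than 2(log₂ d + 1). -/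
/-- The comparison function `C((u,v); w, p) = sign(log M(u;w,p) - log M(v;w,p))`. -/
noncomputable def pcmp {d : ℕ} (u v w : Fin d → ℝ) (p : ℝ) : ℝ :=
  sgn (Real.log (pmean u w p) - Real.log (pmean v w p))

lemma sgn_eq_of_iff {a b : ℝ} (h : 0 ≤ a ↔ 0 ≤ b) : sgn a = sgn b := by
  unfold sgn; simp only [h]

lemma sgn_cases (a : ℝ) : sgn a = 1 ∨ sgn a = -1 := by
  unfold sgn; split_ifs <;> simp

lemma sgn_neg_imp {a b : ℝ} (h : sgn b = - sgn a) :
    (0 ≤ b → a < 0) ∧ (b < 0 → 0 ≤ a) := by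
  unfold sgn at h
  constructor
  · intro hb
    by_contra ha
    rw [if_pos hb, if_pos (not_lt.mp ha)] at h
    norm_num at h
  · intro hb
    by_contra ha
    rw [if_neg (not_le.mpr hb), if_neg ha] at h
    norm_num at h

/-- `F` has at least `K` sign changes (with respect to `sgn`). -/
def AltSgn (F : ℝ → ℝ) (K : ℕ) : Prop :=
  ∃ p : ℕ → ℝ, ∀ i < K, p i < p (i + 1) ∧ sgn (F (p (i + 1))) = - sgn (F (p i))

lemma AltSgn.congr {F G : ℝ → ℝ} {K : ℕ} (h : AltSgn F K) (e : ∀ p, sgn (F p) = sgn (G p)) :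
    AltSgn G K := by
  obtain ⟨p, hp⟩ := h
  exact ⟨p, fun i hi => by simpa only [e] using hp i hi⟩

/-- mean value, comparing to the right end point -/
lemma mvt_right {F F' : ℝ → ℝ} (hF : ∀ x, HasDerivAt F (F' x) x) {a b : ℝ} (hab : a < b)
    (h1 : 0 ≤ F b → F a ≤ 0) (h2 : F b < 0 → 0 ≤ F a) :
    ∃ x, a < x ∧ x < b ∧ sgn (F' x) = sgn (F b) := by
  obtain ⟨x, hx, e⟩ := exists_hasDerivAt_eq_slope F F' hab
    (fun x _ => (hF x).continuousAt.continuousWithinAt) (fun x _ => hF x)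
  refine ⟨x, hx.1, hx.2, sgn_eq_of_iff ?_⟩
  have hba : 0 < b - a := sub_pos.mpr hab
  rw [e]
  constructor
  · intro h
    by_contra hb
    have := h2 (not_le.mp hb)
    have h3 : (F b - F a) / (b - a) < 0 := div_neg_of_neg_of_pos (by linarith) hba
    linarith
  · intro h
    have := h1 h
    exact div_nonneg (by linarith) hba.le

/-- mean value, comparing to the left end point -/
lemma mvt_left {F F' : ℝ → ℝ} (hF : ∀ x, HasDerivAt F (F' x) x) {a b : ℝ} (hab : a < b)
    (h1 : 0 ≤ - F a → 0 ≤ F b) (h2 : - F a < 0 → F b ≤ 0) :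
    ∃ x, a < x ∧ x < b ∧ sgn (F' x) = sgn (- F a) := by
  obtain ⟨x, hx, e⟩ := exists_hasDerivAt_eq_slope F F' hab
    (fun x _ => (hF x).continuousAt.continuousWithinAt) (fun x _ => hF x)
  refine ⟨x, hx.1, hx.2, sgn_eq_of_iff ?_⟩
  have hba : 0 < b - a := sub_pos.mpr hab
  rw [e]
  constructor
  · intro h
    by_contra hb
    have := h2 (not_le.mp hb)
    have h3 : (F b - F a) / (b - a) < 0 := div_neg_of_neg_of_pos (by linarith) hba
    linarith
  · intro h
    have := h1 h
    exact div_nonneg (by linarith) hba.le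

lemma AltSgn.deriv {F F' : ℝ → ℝ} (hF : ∀ x, HasDerivAt F (F' x) x) {K : ℕ}
    (h : AltSgn F (K + 1)) : AltSgn F' K := by
  obtain ⟨p, hp⟩ := h
  have key : ∀ i, ∃ x, i < K + 1 → p i < x ∧ x < p (i + 1) ∧ sgn (F' x) = sgn (F (p (i + 1))) := by
    intro i
    by_cases hi : i < K + 1
    · obtain ⟨h1, h2⟩ := hp i hi
      have h3 := sgn_neg_imp h2
      obtain ⟨x, hx⟩ := mvt_right hF h1 (fun h => (h3.1 h).le) h3.2
      exact ⟨x, fun _ => hx⟩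
    · exact ⟨0, fun h => absurd h hi⟩
  choose x hx using key
  refine ⟨x, fun i hi => ?_⟩
  obtain ⟨a1, a2, a3⟩ := hx i (by omega)
  obtain ⟨b1, b2, b3⟩ := hx (i + 1) (by omega)
  refine ⟨by linarith, ?_⟩
  rw [a3, b3]
  exact (hp (i + 1) (by omega)).2

lemma exp_sum_alt {ι : Type*} [DecidableEq ι] (s : Finset ι) : ∀ (c l : ι → ℝ) (K : ℕ),
    AltSgn (fun p => ∑ i ∈ s, c i * Real.exp (l i * p)) (K + 1) → K + 2 ≤ s.card := by
  induction s using Finset.induction_on with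
  | empty =>
    rintro c l K ⟨p, hp⟩
    have := (hp 0 (by omega)).2
    simp [sgn] at this
    norm_num at this
  | insert a s ha ih =>
    intro c l K h
    have h1 : AltSgn (fun p => c a + ∑ i ∈ s, c i * Real.exp ((l i - l a) * p)) (K + 1) := by
      refine h.congr fun p => sgn_eq_of_iff ?_
      have : ∑ i ∈ insert a s, c i * Real.exp (l i * p) =
          (c a + ∑ i ∈ s, c i * Real.exp ((l i - l a) * p)) * Real.exp (l a * p) := by
        rw [Finset.sum_insert ha, add_mul, Finset.sum_mul]
        congr 1
        refine Finset.sum_congr rfl fun i _ => ?_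
        rw [mul_assoc, ← Real.exp_add]
        congr 2; ring
      simp only [this]
      exact mul_nonneg_iff_of_pos_right (Real.exp_pos _)
    rw [Finset.card_insert_of_notMem ha]
    have h2 : AltSgn (fun p => ∑ i ∈ s, (c i * (l i - l a)) * Real.exp ((l i - l a) * p)) K := by
      refine h1.deriv fun x => ?_
      refine HasDerivAt.const_add _ ?_
      refine HasDerivAt.fun_sum fun i _ => ?_
      have := (((hasDerivAt_id' x).const_mul (l i - l a)).exp).const_mul (c i)
      exact this.congr_deriv (by ring)
    cases K with
    | succ K => have := ih _ _ _ h2; omega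
    | zero =>
      rcases s.eq_empty_or_nonempty with rfl | hs
      · obtain ⟨p, hp⟩ := h1
        have := (hp 0 (by omega)).2
        simp only [Finset.sum_empty] at this
        rcases sgn_cases (c a + 0) with h | h <;> rw [h] at this <;> norm_num at this
      · have := hs.card_pos; omega

lemma alt_div {g g' h : ℝ → ℝ} (hg : ∀ x, HasDerivAt g (g' x) x) (g0 : g 0 = 0)
    (hpos : ∀ p, 0 < p → sgn (h p) = sgn (g p)) (hneg : ∀ p, p < 0 → sgn (h p) = sgn (- g p))
    (hz : sgn (h 0) = sgn (g' 0)) {K : ℕ} (H : AltSgn h K) : AltSgn g' K := by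
  obtain ⟨p, hp⟩ := H
  have key : ∀ i, ∃ x, i ≤ K → sgn (g' x) = sgn (h (p i)) ∧ (p i = 0 → x = 0) ∧
      (0 < p i → 0 < x ∧ x < p i ∧ ∀ j, j + 1 = i → p j < x) ∧
      (p i < 0 → p i < x ∧ x < 0 ∧ (i < K → x < p (i + 1))) := by
    intro i
    by_cases hi : i ≤ K
    swap
    · exact ⟨0, fun h => absurd h hi⟩
    rcases lt_trichotomy (p i) 0 with h0 | h0 | h0
    · by_cases hc : i < K ∧ p (i + 1) < 0
      · obtain ⟨hc, hc'⟩ := hc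
        obtain ⟨e1, e2⟩ := hp i hc
        rw [hneg _ hc', hneg _ h0] at e2
        have e3 := sgn_neg_imp e2
        obtain ⟨x, x1, x2, x3⟩ := mvt_left hg e1
          (fun h => by by_contra h'; have := e3.1 (by linarith); linarith)
          (fun h => by by_contra h'; have := e3.2 (by linarith); linarith)
        refine ⟨x, fun _ => ⟨by rw [x3, hneg _ h0], fun h => by linarith, fun h => by linarith,
          fun _ => ⟨x1, by linarith, fun _ => x2⟩⟩⟩
      · obtain ⟨x, x1, x2, x3⟩ := mvt_left hg h0 (fun _ => g0.ge) (fun _ => g0.le)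
        refine ⟨x, fun _ => ⟨by rw [x3, hneg _ h0], fun h => by linarith, fun h => by linarith,
          fun _ => ⟨x1, by linarith, fun hK => ?_⟩⟩⟩
        have : ¬ p (i + 1) < 0 := fun h => hc ⟨hK, h⟩
        linarith
    · refine ⟨0, fun _ => ⟨by rw [h0, hz], fun _ => rfl, fun h => by linarith,
        fun h => by linarith⟩⟩
    · by_cases hc : ∃ j, j + 1 = i ∧ 0 < p j
      · obtain ⟨j, rfl, hc'⟩ := hc
        obtain ⟨e1, e2⟩ := hp j (by omega)
        rw [hpos _ hc', hpos _ h0] at e2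
        have e3 := sgn_neg_imp e2
        obtain ⟨x, x1, x2, x3⟩ := mvt_right hg e1 (fun h => (e3.1 h).le) e3.2
        refine ⟨x, fun _ => ⟨by rw [x3, hpos _ h0], fun h => by linarith,
          fun _ => ⟨by linarith, x2, fun j' hj' => ?_⟩, fun h => by linarith⟩⟩
        obtain rfl : j' = j := by omega
        exact x1
      · obtain ⟨x, x1, x2, x3⟩ := mvt_right hg h0 (fun _ => g0.le) (fun _ => g0.ge)
        refine ⟨x, fun _ => ⟨by rw [x3, hpos _ h0], fun h => by linarith,
          fun _ => ⟨by linarith, x2, fun j' hj' => ?_⟩, fun h => by linarith⟩⟩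
        have : ¬ 0 < p j' := fun h => hc ⟨j', hj', h⟩
        linarith
  choose x hx using key
  refine ⟨x, fun i hi => ?_⟩
  obtain ⟨a1, a2, a3, a4⟩ := hx i (by omega)
  obtain ⟨b1, b2, b3, b4⟩ := hx (i + 1) (by omega)
  obtain ⟨e1, e2⟩ := hp i hi
  refine ⟨?_, by rw [a1, b1, e2]⟩
  rcases lt_trichotomy (p i) 0 with h0 | h0 | h0
  · obtain ⟨c1, c2, c3⟩ := a4 h0
    rcases lt_trichotomy (p (i + 1)) 0 with h1 | h1 | h1
    · have := (b4 h1).1; have := c3 hi; linarith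
    · rw [b2 h1]; exact c2
    · have := (b3 h1).1; linarith
  · rw [a2 h0]; exact (b3 (by linarith)).1
  · have := (b3 (by linarith)).2.2 i rfl
    have := (a3 h0).2.1
    linarith

lemma alt_of_changes (h : ℝ → ℝ) (q : ℕ → ℝ) (n : ℕ) (hq : ∀ i < n, q i < q (i + 1)) :
    AltSgn h ((Finset.range n).filter
      (fun i => sgn (h (q i)) ≠ sgn (h (q (i + 1))))).card := by
  suffices H : ∃ p : ℕ → ℝ, (∀ i < ((Finset.range n).filter
      (fun i => sgn (h (q i)) ≠ sgn (h (q (i + 1))))).card,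
        p i < p (i + 1) ∧ sgn (h (p (i + 1))) = - sgn (h (p i))) ∧
      p ((Finset.range n).filter
      (fun i => sgn (h (q i)) ≠ sgn (h (q (i + 1))))).card ≤ q n ∧
      sgn (h (p ((Finset.range n).filter
      (fun i => sgn (h (q i)) ≠ sgn (h (q (i + 1))))).card)) = sgn (h (q n)) by
    obtain ⟨p, hp, -⟩ := H
    exact ⟨p, hp⟩
  induction n with
  | zero => exact ⟨q, by simp, by simp, by simp⟩
  | succ n ih =>
    obtain ⟨p, hp, h1, h2⟩ := ih (fun i hi => hq i (by omega))
    have hn := hq n (by omega)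
    rw [Finset.range_add_one, Finset.filter_insert]
    by_cases hc : sgn (h (q n)) ≠ sgn (h (q (n + 1)))
    · rw [if_pos hc, Finset.card_insert_of_notMem (by simp)]
      generalize ((Finset.range n).filter
        (fun i => sgn (h (q i)) ≠ sgn (h (q (i + 1))))).card = C at *
      refine ⟨fun i => if i ≤ C then p i else q (n + 1), fun i hi => ?_, by simp, by simp⟩
      rcases Nat.lt_succ_iff_lt_or_eq.mp hi with hi' | rfl
      · have e1 : i ≤ C := hi'.le
        have e2 : i + 1 ≤ C := hi'
        simp only [e1, e2, if_true]
        exact hp i hi'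
      · simp only [le_refl, if_true, Nat.not_succ_le_self, if_false]
        refine ⟨by linarith, ?_⟩
        rw [h2]
        rcases sgn_cases (h (q n)) with e | e <;>
          rcases sgn_cases (h (q (n + 1))) with e' | e' <;> rw [e, e'] at hc ⊢ <;> simp at hc ⊢
    · rw [if_neg hc]
      refine ⟨p, hp, by linarith, ?_⟩
      rw [h2]; exact not_not.mp hc

lemma pcmp_alt {d : ℕ} (w : Fin d → ℝ) (hw : inSimplex w) (u v : Fin d → ℝ)
    (hu : ∀ i, 0 < u i) (hv : ∀ i, 0 < v i) (K : ℕ)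
    (H : AltSgn (fun p => Real.log (pmean u w p) - Real.log (pmean v w p)) (K + 1)) :
    K + 2 ≤ 2 * d := by
  obtain ⟨hw0, hw1⟩ := hw
  obtain ⟨i0, hi0⟩ : ∃ i, 0 < w i := by
    by_contra hcon
    push Not at hcon
    have : ∑ i, w i ≤ 0 := Finset.sum_nonpos fun i _ => hcon i
    linarith
  have Spos : ∀ (x : Fin d → ℝ), (∀ i, 0 < x i) → ∀ p : ℝ, 0 < ∑ i, w i * x i ^ p := by
    intro x hx p
    refine Finset.sum_pos' (fun i _ => mul_nonneg (hw0 i) (Real.rpow_pos_of_pos (hx i) p).le)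
      ⟨i0, Finset.mem_univ _, mul_pos hi0 (Real.rpow_pos_of_pos (hx i0) p)⟩
  have Sexp : ∀ (x : Fin d → ℝ), (∀ i, 0 < x i) → ∀ p : ℝ, ∑ i, w i * x i ^ p =
      ∑ i, w i * Real.exp (Real.log (x i) * p) := by
    intro x hx p
    exact Finset.sum_congr rfl fun i _ => by rw [Real.rpow_def_of_pos (hx i)]
  have Sder : ∀ (x : Fin d → ℝ) (p : ℝ),
      HasDerivAt (fun p => ∑ i, w i * Real.exp (Real.log (x i) * p))
        (∑ i, (w i * Real.log (x i)) * Real.exp (Real.log (x i) * p)) p := by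
    intro x p
    refine HasDerivAt.fun_sum fun i _ => ?_
    have := (((hasDerivAt_id' p).const_mul (Real.log (x i))).exp).const_mul (w i)
    exact this.congr_deriv (by ring)
  have Mlog : ∀ (x : Fin d → ℝ), (∀ i, 0 < x i) → ∀ p, p ≠ 0 →
      Real.log (pmean x w p) = 1 / p * Real.log (∑ i, w i * Real.exp (Real.log (x i) * p)) := by
    intro x hx p hp
    rw [pmean, if_neg hp, Real.log_rpow (Spos x hx p), Sexp x hx]
  have Mlog0 : ∀ (x : Fin d → ℝ), (∀ i, 0 < x i) →
      Real.log (pmean x w 0) = ∑ i, w i * Real.log (x i) := by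
    intro x hx
    rw [pmean, if_pos rfl, Real.log_prod (fun i _ => (Real.rpow_pos_of_pos (hx i) _).ne')]
    exact Finset.sum_congr rfl fun i _ => Real.log_rpow (hx i) _
  have Spos' : ∀ (x : Fin d → ℝ), (∀ i, 0 < x i) → ∀ p,
      0 < ∑ i, w i * Real.exp (Real.log (x i) * p) := fun x hx p => Sexp x hx p ▸ Spos x hx p
  have H2 := alt_div (fun p => (Sder u p).fun_sub (Sder v p)) (by simp) ?_ ?_ ?_ H
  · have H3 := exp_sum_alt (Finset.univ : Finset (Fin d ⊕ Fin d))
      (Sum.elim (fun i => w i * Real.log (u i)) (fun i => - (w i * Real.log (v i))))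
      (Sum.elim (fun i => Real.log (u i)) (fun i => Real.log (v i))) K
      (H2.congr fun p => by
        congr 1
        simp [Fintype.sum_sum_type, sub_eq_add_neg])
    simpa [two_mul] using H3
  · intro p hp
    refine sgn_eq_of_iff ?_
    simp only [Mlog u hu p hp.ne', Mlog v hv p hp.ne']
    rw [← mul_sub, mul_nonneg_iff_of_pos_left (by positivity), sub_nonneg, sub_nonneg,
      Real.log_le_log_iff (Spos' v hv p) (Spos' u hu p)]
  · intro p hp
    refine sgn_eq_of_iff ?_
    simp only [Mlog u hu p hp.ne, Mlog v hv p hp.ne]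
    rw [← mul_sub, ← neg_mul_neg, neg_sub, neg_sub,
      mul_nonneg_iff_of_pos_left (by rw [neg_pos]; exact one_div_neg.mpr hp), sub_nonneg, sub_nonneg,
      Real.log_le_log_iff (Spos' u hu p) (Spos' v hv p)]
  · simp only [Mlog0 u hu, Mlog0 v hv, mul_zero, Real.exp_zero, mul_one]

/-- For a fixed weight vector, no sequence of `m = 2(⌈log₂ d⌉ + 1)` pairs of
positive vectors is shattered by the comparison class `{(u,v) ↦ C((u,v); w, p) : p ∈ ℝ}`;
hence its VC dimension is less than `2(log₂ d + 1)`. -/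
theorem vc_comparison_known_weights (d : ℕ) (hd : 2 ≤ d)
    (w : Fin d → ℝ) (hw : inSimplex w) :
    ∀ u v : Fin (2 * (⌈Real.logb 2 d⌉₊ + 1)) → Fin d → ℝ,
      (∀ j i, 0 < u j i) → (∀ j i, 0 < v j i) →
      ∃ b : Fin (2 * (⌈Real.logb 2 d⌉₊ + 1)) → ℝ,
        (∀ j, b j = 1 ∨ b j = -1) ∧
        ¬ ∃ p : ℝ, ∀ j, pcmp (u j) (v j) w p = b j := by
  have hdk : d ≤ 2 ^ ⌈Real.logb 2 d⌉₊ := by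
    have h1 : Real.logb 2 d ≤ (⌈Real.logb 2 d⌉₊ : ℝ) := Nat.le_ceil _
    rw [Real.logb_le_iff_le_rpow (by norm_num) (by positivity), Real.rpow_natCast] at h1
    exact_mod_cast h1
  generalize ⌈Real.logb 2 d⌉₊ = k at hdk
  intro u v hu hv
  by_contra hcon
  push Not at hcon
  have hP : ∀ b : Fin (2 * (k + 1)) → Bool, ∃ p : ℝ, ∀ j,
      pcmp (u j) (v j) w p = if b j then 1 else -1 := fun b =>
    hcon (fun j => if b j then 1 else -1) (fun j => by by_cases h : b j <;> simp [h])
  choose P hP using hP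
  have Pinj : Function.Injective P := by
    intro b b' e
    funext j
    have h1 := hP b j
    have h2 := hP b' j
    rw [e, h2] at h1
    cases hb : b j <;> cases hb' : b' j <;> simp [hb, hb'] at h1 ⊢ <;> norm_num at h1
  let S : Finset ℝ := Finset.univ.image P
  have hS : S.card = 2 ^ (2 * (k + 1)) := by
    rw [Finset.card_image_of_injective _ Pinj]; simp
  let e := S.orderEmbOfFin hS
  let q : ℕ → ℝ := fun i => if h : i < 2 ^ (2 * (k + 1)) then e ⟨i, h⟩ else 0
  have hq : ∀ i < 2 ^ (2 * (k + 1)) - 1, q i < q (i + 1) := by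
    intro i hi
    have a1 : i < 2 ^ (2 * (k + 1)) := by omega
    have a2 : i + 1 < 2 ^ (2 * (k + 1)) := by omega
    simp only [q, a1, a2, dif_pos]
    exact e.strictMono (by simp [Fin.lt_def])
  have hmem : ∀ i < 2 ^ (2 * (k + 1)), ∃ b, P b = q i := by
    intro i hi
    have : e ⟨i, hi⟩ ∈ S := S.orderEmbOfFin_mem hS _
    simp only [q, hi, dif_pos]
    simpa [S] using this
  let h : Fin (2 * (k + 1)) → ℝ → ℝ := fun j p =>
    Real.log (pmean (u j) w p) - Real.log (pmean (v j) w p)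
  have bound : ∀ j, ((Finset.range (2 ^ (2 * (k + 1)) - 1)).filter
      (fun i => sgn (h j (q i)) ≠ sgn (h j (q (i + 1))))).card ≤ 2 * d - 1 := by
    intro j
    have := alt_of_changes (h j) q _ hq
    revert this
    generalize ((Finset.range (2 ^ (2 * (k + 1)) - 1)).filter
      (fun i => sgn (h j (q i)) ≠ sgn (h j (q (i + 1))))).card = C
    intro this
    cases C with
    | zero => omega
    | succ C =>
      have := pcmp_alt w hw (u j) (v j) (hu j) (hv j) C this
      omega
  have cover : Finset.range (2 ^ (2 * (k + 1)) - 1) ⊆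
      Finset.univ.biUnion fun j => (Finset.range (2 ^ (2 * (k + 1)) - 1)).filter
      (fun i => sgn (h j (q i)) ≠ sgn (h j (q (i + 1)))) := by
    intro i hi
    have hi' := Finset.mem_range.mp hi
    simp only [Finset.mem_biUnion, Finset.mem_univ, true_and, Finset.mem_filter, hi]
    by_contra hno
    push Not at hno
    obtain ⟨b, hb⟩ := hmem i (by omega)
    obtain ⟨b', hb'⟩ := hmem (i + 1) (by omega)
    have hbb : b = b' := by
      funext j
      have h1 := hP b j
      have h2 := hP b' j
      have h3 : pcmp (u j) (v j) w (P b) = pcmp (u j) (v j) w (P b') := by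
        rw [hb, hb']; exact hno j
      rw [h3, h2] at h1
      cases hb : b j <;> cases hb' : b' j <;> simp [hb, hb'] at h1 ⊢ <;> norm_num at h1
    have := hq i hi'
    rw [← hb, ← hb', hbb] at this
    exact lt_irrefl _ this
  have c1 := Finset.card_le_card cover
  have c2 := c1.trans (Finset.card_biUnion_le_card_mul _ _ _ fun j _ => bound j)
  simp only [Finset.card_range, Finset.card_univ, Fintype.card_fin] at c2
  have hk : k + 1 ≤ 2 ^ k := Nat.lt_two_pow_self
  have e1 : 2 ^ (2 * (k + 1)) = 4 * (2 ^ k * 2 ^ k) := by ring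
  rw [e1] at c2
  generalize 2 ^ k = T at *
  have c3 : 2 * (k + 1) * (2 * d - 1) ≤ 2 * T * (2 * T - 1) :=
    Nat.mul_le_mul (by omega) (by omega)
  have c4 : 2 * T * (2 * T - 1) + 2 * T = 4 * (T * T) := by
    obtain ⟨n, rfl⟩ : ∃ n, T = n + 1 := ⟨T - 1, by omega⟩
    have : 2 * (n + 1) - 1 = 2 * n + 1 := by omega
    rw [this]; ring
  omega
end

section
/- Fix d ≥ 2, 0 < u_min ≤ u_max, a weight vector w ∈ Δ_{d−1}, a Borel probability measure D on [u_min, u_max]^d × [u_min, u_max]^d × {−1, +1}, n ≥ 1, and δ > 0. Let ((u_1, v_1), y_1), …, ((u_n, v_n), y_n) be drawn i.i.d. from D and let p̂ ∈ ℝ be any empirical risk minimizer, i.e., R̂_n(w, p̂) = inf_{p ∈ ℝ} R̂_n(w, p) (assumed to be attained). Then with probability at least 1 − δ over the sample, R(w, p̂) − inf_{p ∈ ℝ} R(w, p) ≤ 16 √((2(log₂ d + 1) log(n + 1) + log(8/δ))/n). -/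
open MeasureTheory

theorem zeros_rolle (g g' : ℝ → ℝ) (hg : ∀ x, HasDerivAt g (g' x) x) (k : ℕ)
    (hk : {x | g' x = 0}.encard ≤ k) : {x | g x = 0}.encard ≤ (k + 1 : ℕ) := by
  have hfin : {x | g' x = 0}.Finite := Set.finite_of_encard_le_coe hk
  by_contra hcon
  push Not at hcon
  have h2 : ((k + 2 : ℕ) : ℕ∞) ≤ {x | g x = 0}.encard := by
    have := Order.add_one_le_of_lt hcon
    exact_mod_cast this
  obtain ⟨T, hTs, hTc⟩ := Set.exists_subset_encard_eq h2
  have hTf : T.Finite := Set.finite_of_encard_eq_coe hTc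
  have := Finset.card_le_of_interleaved (s := hTf.toFinset) (t := hfin.toFinset) (by
    intro x hx y hy hxy _
    have hx' : g x = 0 := hTs (by simpa using hx)
    have hy' : g y = 0 := hTs (by simpa using hy)
    obtain ⟨c, hc, hc0⟩ := exists_hasDerivAt_eq_zero (f := g) (f' := g') hxy
      (fun t _ => (hg t).continuousAt.continuousWithinAt) (by rw [hx', hy'])
      (fun t _ => hg t)
    exact ⟨c, by simpa using hc0, hc.1, hc.2⟩)
  rw [hTf.encard_eq_coe_toFinset_card] at hTc
  rw [hfin.encard_eq_coe_toFinset_card] at hk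
  have h3 : hTf.toFinset.card = k + 2 := by exact_mod_cast hTc
  have h4 : hfin.toFinset.card ≤ k := by exact_mod_cast hk
  omega

theorem expsum_zeros_s10 (m : ℕ) : ∀ (c l : Fin m → ℝ),
    (∀ x, ∑ i, c i * Real.exp (l i * x) = 0) ∨
      {x : ℝ | ∑ i, c i * Real.exp (l i * x) = 0}.encard ≤ m := by
  induction m with
  | zero => intro c l; left; simp
  | succ m ih =>
    intro c l
    set g : ℝ → ℝ := fun x => c (Fin.last m) +
      ∑ i : Fin m, c i.castSucc * Real.exp ((l i.castSucc - l (Fin.last m)) * x) with hgdef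
    set g' : ℝ → ℝ := fun x =>
      ∑ i : Fin m, (c i.castSucc * (l i.castSucc - l (Fin.last m))) *
        Real.exp ((l i.castSucc - l (Fin.last m)) * x) with hg'def
    have hfg : ∀ x, ∑ i, c i * Real.exp (l i * x) = Real.exp (l (Fin.last m) * x) * g x := by
      intro x
      rw [Fin.sum_univ_castSucc, hgdef]
      simp only [mul_add, Finset.mul_sum]
      rw [add_comm, mul_comm]
      congr 1
      refine Finset.sum_congr rfl fun i _ => ?_
      rw [mul_left_comm, ← Real.exp_add]
      congr 2
      ring
    have hz : ∀ x, ∑ i, c i * Real.exp (l i * x) = 0 ↔ g x = 0 := by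
      intro x; rw [hfg]; simp [Real.exp_ne_zero]
    have hd : ∀ x, HasDerivAt g (g' x) x := by
      intro x
      refine HasDerivAt.const_add _ (HasDerivAt.fun_sum fun i _ => ?_)
      have := (((hasDerivAt_id x).const_mul (l i.castSucc - l (Fin.last m))).exp).const_mul
        (c i.castSucc)
      refine this.congr_deriv ?_
      simp only [id]; ring
    simp only [hz]
    rcases ih (fun i => c i.castSucc * (l i.castSucc - l (Fin.last m)))
      (fun i => l i.castSucc - l (Fin.last m)) with h | h
    · have hconst : ∀ x y, g x = g y := is_const_of_deriv_eq_zero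
        (fun x => (hd x).differentiableAt) (fun x => by rw [(hd x).deriv]; exact h x)
      by_cases h0 : g 0 = 0
      · left; intro x; rw [hconst x 0, h0]
      · right
        have : {x | g x = 0} = ∅ := by
          ext x; simp [hconst x 0, h0]
        rw [this]; simp
    · right
      exact zeros_rolle g g' hd m h

theorem hoeff {Z : Type*} [MeasurableSpace Z] (D : Measure Z) [IsProbabilityMeasure D]
    (n : ℕ) (hn : 1 ≤ n) (g : Z → ℝ) (hg : Measurable g) (h01 : ∀ z, g z ∈ Set.Icc (0:ℝ) 1)
    (t : ℝ) (ht : 0 ≤ t) :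
    (Measure.pi fun _ : Fin n => D) {s | (∫ z, g z ∂D) + t ≤ (1 / n : ℝ) * ∑ i, g (s i)}
      ≤ ENNReal.ofReal (Real.exp (-2 * n * t ^ 2)) := by
  have hn0 : (0:ℝ) < n := by exact_mod_cast hn
  set μ := (Measure.pi fun _ : Fin n => D)
  have hmean : ∀ i : Fin n, ∫ s, g (s i) ∂μ = ∫ z, g z ∂D := by
    intro i
    have := (measurePreserving_eval (fun _ : Fin n => D) i).map_eq
    conv_rhs => rw [← this]
    rw [integral_map (measurable_pi_apply i).aemeasurable hg.aestronglyMeasurable]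
  have hind : ProbabilityTheory.iIndepFun
      (fun (i : Fin n) (s : Fin n → Z) => g (s i) - ∫ z, g z ∂D) μ :=
    ProbabilityTheory.iIndepFun_pi (μ := fun _ : Fin n => D)
      (X := fun _ z => g z - ∫ z, g z ∂D) (fun i => (hg.sub_const _).aemeasurable)
  have hsub : ∀ i ∈ (Finset.univ : Finset (Fin n)), ProbabilityTheory.HasSubgaussianMGF
      (fun (s : Fin n → Z) => g (s i) - ∫ z, g z ∂D) ((‖(1:ℝ) - 0‖₊ / 2) ^ 2) μ := by
    intro i _
    rw [← hmean i]
    exact ProbabilityTheory.hasSubgaussianMGF_of_mem_Icc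
      (hg.comp (measurable_pi_apply i)).aemeasurable (ae_of_all _ fun s => h01 (s i))
  have := ProbabilityTheory.HasSubgaussianMGF.measure_sum_ge_le_of_iIndepFun hind hsub
    (ε := n * t) (by positivity)
  rw [← ENNReal.ofReal_toReal (measure_ne_top μ _)]
  apply ENNReal.ofReal_le_ofReal
  refine le_trans (le_of_eq ?_) (this.trans (le_of_eq ?_))
  · rw [Measure.real]
    congr 2
    ext s
    simp only [Set.mem_ofPred_eq, Finset.sum_sub_distrib, Finset.sum_const, Finset.card_univ,
      Fintype.card_fin, nsmul_eq_mul]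
    rw [one_div, le_inv_mul_iff₀ hn0, mul_add]
    constructor <;> intro h <;> linarith
  · congr 1
    simp
    field_simp

theorem hoeff2 {Z : Type*} [MeasurableSpace Z] (D : Measure Z) [IsProbabilityMeasure D]
    (n : ℕ) (hn : 1 ≤ n) (g : Z → ℝ) (hg : Measurable g) (h01 : ∀ z, g z ∈ Set.Icc (0:ℝ) 1)
    (t : ℝ) (ht : 0 ≤ t) :
    (Measure.pi fun _ : Fin n => D) {s | (1 / n : ℝ) * ∑ i, g (s i) ≤ (∫ z, g z ∂D) - t}
      ≤ ENNReal.ofReal (Real.exp (-2 * n * t ^ 2)) := by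
  have hn0 : (0:ℝ) < n := by exact_mod_cast hn
  refine le_trans (le_of_eq ?_) (hoeff D n hn (fun z => 1 - g z) (measurable_const.sub hg)
    (fun z => ⟨by linarith [(h01 z).2], by linarith [(h01 z).1]⟩) t ht)
  congr 1
  ext s
  have hi : Integrable g D := Integrable.of_mem_Icc 0 1 hg.aemeasurable (ae_of_all _ h01)
  rw [Set.mem_ofPred_eq, Set.mem_ofPred_eq, integral_sub (integrable_const _) hi]
  simp only [Finset.sum_sub_distrib, Finset.sum_const, Finset.card_univ,
      Fintype.card_fin, nsmul_eq_mul, integral_const, probReal_univ, mul_sub]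
  have : (1 / n : ℝ) * (n * 1) = 1 := by field_simp
  rw [this]
  simp
  constructor <;> intro h <;> linarith

theorem bracket {Z P ι : Type*} [MeasurableSpace Z] (D : Measure Z) [IsProbabilityMeasure D]
    [Fintype ι] (n : ℕ) (hn : 1 ≤ n) (f : P → Z → ℝ) (hf : ∀ p, Measurable (f p))
    (h01 : ∀ p z, f p z ∈ Set.Icc (0:ℝ) 1) (t η : ℝ) (ht : 0 ≤ t) (hη : 0 ≤ η)
    (c : ι → P) (B : ι → Set Z) (hB : ∀ i, MeasurableSet (B i))
    (hBη : ∀ i, D (B i) ≤ ENNReal.ofReal η)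
    (hcov : ∀ p, ∃ i, ∀ z, z ∉ B i → f p z = f (c i) z) :
    (Measure.pi fun _ : Fin n => D)
      {s | ∃ p, 2 * t + 2 * η < |(1 / n : ℝ) * ∑ i, f p (s i) - ∫ z, f p z ∂D|}
      ≤ Fintype.card ι * (3 * ENNReal.ofReal (Real.exp (-2 * n * t ^ 2))) := by
  have hn0 : (0:ℝ) < n := by exact_mod_cast hn
  have hfint : ∀ p, Integrable (f p) D := fun p =>
    Integrable.of_mem_Icc 0 1 (hf p).aemeasurable (ae_of_all _ (h01 p))
  set b : ι → Z → ℝ := fun i => (B i).indicator 1 with hbdef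
  have hbm : ∀ i, Measurable (b i) := fun i => measurable_one.indicator (hB i)
  have hb01 : ∀ i z, b i z ∈ Set.Icc (0:ℝ) 1 := by
    intro i z
    by_cases hz : z ∈ B i <;> simp [hbdef, hz]
  have hbint : ∀ i, Integrable (b i) D := fun i =>
    Integrable.of_mem_Icc 0 1 (hbm i).aemeasurable (ae_of_all _ (hb01 i))
  have hbI : ∀ i, ∫ z, b i z ∂D ≤ η := by
    intro i
    rw [hbdef, integral_indicator_one (hB i), Measure.real]
    exact ENNReal.toReal_le_of_le_ofReal hη (hBη i)
  have hdiff : ∀ p i, (∀ z, z ∉ B i → f p z = f (c i) z) → ∀ z, |f p z - f (c i) z| ≤ b i z := by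
    intro p i h z
    by_cases hz : z ∈ B i
    · simp only [hbdef, hz, Set.indicator_of_mem, Pi.one_apply]
      rw [abs_le]
      constructor <;> linarith [(h01 p z).1, (h01 p z).2, (h01 (c i) z).1, (h01 (c i) z).2]
    · simp [hbdef, hz, h z hz]
  have hsub : {s : Fin n → Z |
      ∃ p, 2 * t + 2 * η < |(1 / n : ℝ) * ∑ i, f p (s i) - ∫ z, f p z ∂D|} ⊆
      ⋃ j : ι, (({s : Fin n → Z |
        (∫ z, f (c j) z ∂D) + t ≤ (1 / n : ℝ) * ∑ i, f (c j) (s i)} ∪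
        {s | (1 / n : ℝ) * ∑ i, f (c j) (s i) ≤ (∫ z, f (c j) z ∂D) - t}) ∪
        {s | (∫ z, b j z ∂D) + t ≤ (1 / n : ℝ) * ∑ i, b j (s i)}) := by
    rintro s ⟨p, hp⟩
    obtain ⟨j, hj⟩ := hcov p
    rw [Set.mem_iUnion]
    refine ⟨j, ?_⟩
    by_contra hcon
    simp only [Set.mem_union, Set.mem_ofPred_eq, not_or, not_le] at hcon
    obtain ⟨⟨h1, h2⟩, h3⟩ := hcon
    have h4 : |(1 / n : ℝ) * ∑ i, f p (s i) - (1 / n : ℝ) * ∑ i, f (c j) (s i)| ≤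
        (1 / n : ℝ) * ∑ i, b j (s i) := by
      rw [← mul_sub, ← Finset.sum_sub_distrib, abs_mul, abs_of_pos (by positivity)]
      refine mul_le_mul_of_nonneg_left ?_ (by positivity)
      exact (Finset.abs_sum_le_sum_abs _ _).trans
        (Finset.sum_le_sum fun i _ => hdiff p j hj (s i))
    have h5 : |(∫ z, f p z ∂D) - ∫ z, f (c j) z ∂D| ≤ ∫ z, b j z ∂D := by
      rw [← integral_sub (hfint _) (hfint _)]
      exact (abs_integral_le_integral_abs).trans
        (integral_mono ((hfint _).sub (hfint _)).abs (hbint _) (hdiff p j hj))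
    have h6 := hbI j
    rw [abs_le] at h4 h5
    rcases lt_abs.1 hp with h | h <;> linarith [h4.1, h4.2, h5.1, h5.2]
  refine (measure_mono hsub).trans ((measure_iUnion_fintype_le _ _).trans ?_)
  refine (Finset.sum_le_card_nsmul _ _ (3 * ENNReal.ofReal (Real.exp (-2 * n * t ^ 2)))
    fun j _ => ?_).trans (by simp)
  refine (measure_union_le _ _).trans ?_
  refine (add_le_add ((measure_union_le _ _).trans (add_le_add
    (hoeff D n hn _ (hf _) (h01 _) t ht) (hoeff2 D n hn _ (hf _) (h01 _) t ht)))
    (hoeff D n hn _ (hbm _) (hb01 _) t ht)).trans (le_of_eq ?_)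
  ring

/-- Partition of the parameter line. -/
theorem cells {Z : Type*} [MeasurableSpace Z] (D : Measure Z)
    (φ : ℝ → ℝ) (hφ : Monotone φ) (K η : ℝ) (hφ0 : ∀ p, 0 ≤ φ p) (hφK : ∀ p, φ p ≤ K)
    (hη : 0 < η) (E : ℝ → ℝ → Set Z)
    (hmono : ∀ a b a' b', a' ≤ a → b ≤ b' → E a b ⊆ E a' b')
    (hE : ∀ a b b', a ≤ b → b < b' → D (E a b) ≤ ENNReal.ofReal (φ b' - φ a))
    (N : ℕ) (hN : K / η < N) :
    ∃ (c : Option (Fin N × Bool) → ℝ) (B : Option (Fin N × Bool) → Set Z),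
      (∀ i, MeasurableSet (B i)) ∧ (∀ i, D (B i) ≤ ENNReal.ofReal η) ∧
      ∀ p, ∃ i, p = c i ∨ (p ≠ 0 ∧ c i ≠ 0 ∧ E (min p (c i)) (max p (c i)) ⊆ B i) := by
  classical
  set J : ℕ → Set ℝ := fun j => {p | ⌊φ p / η⌋₊ = j} with hJ
  set I : ℕ → Set ℝ := fun j => {p | p ∈ J j ∧ ∃ b ∈ J j, p < b} with hI
  have hJoc : ∀ j a b x, a ∈ J j → b ∈ J j → a ≤ x → x ≤ b → x ∈ J j := by
    intro j a b x ha hb hax hxb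
    simp only [hJ, Set.mem_ofPred_eq] at ha hb ⊢
    apply le_antisymm
    · rw [← hb]; exact Nat.floor_mono (div_le_div_of_nonneg_right (hφ hxb) hη.le)
    · rw [← ha]; exact Nat.floor_mono (div_le_div_of_nonneg_right (hφ hax) hη.le)
  have hIoc : ∀ j, (I j).OrdConnected := by
    intro j
    refine ⟨fun a ha b hb x hx => ?_⟩
    obtain ⟨ha1, _⟩ := ha
    obtain ⟨hb1, b', hb', hbb'⟩ := hb
    exact ⟨hJoc j a b x ha1 hb1 hx.1 hx.2, b', hb', lt_of_le_of_lt hx.2 hbb'⟩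
  set EI : ℕ → Set Z := fun j => ⋃ q : (I j)ᵒᵈ × (I j),
    E ((OrderDual.ofDual q.1 : I j) : ℝ) (q.2 : ℝ) with hEI
  have hEE : ∀ j a b, a ∈ I j → b ∈ I j → D (E a b) ≤ ENNReal.ofReal η := by
    intro j a b ha hb
    obtain ⟨b', hb', hbb'⟩ := hb.2
    have key : ∀ a' ∈ J j, φ b' - φ a' ≤ η := by
      intro a' ha'
      have h1 : φ b' / η < j + 1 := by
        have := Nat.lt_floor_add_one (φ b' / η)
        simp only [hJ, Set.mem_ofPred_eq] at hb'
        rwa [hb'] at this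
      have h2 : (j : ℝ) ≤ φ a' / η := by
        have := Nat.floor_le (div_nonneg (hφ0 a') hη.le)
        simp only [hJ, Set.mem_ofPred_eq] at ha'
        rwa [ha'] at this
      rw [div_lt_iff₀ hη] at h1
      rw [le_div_iff₀ hη] at h2
      linarith
    rcases le_total a b with hab | hab
    · exact (hE a b b' hab hbb').trans (ENNReal.ofReal_le_ofReal (key a ha.1))
    · exact (measure_mono (hmono a b b b hab le_rfl)).trans
        ((hE b b b' le_rfl hbb').trans (ENNReal.ofReal_le_ofReal (key b hb.1)))
  have hEIη : ∀ j, D (EI j) ≤ ENNReal.ofReal η := by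
    intro j
    have := hIoc j
    rw [hEI]
    rw [Monotone.measure_iUnion (μ := D)]
    · exact iSup_le fun q => hEE j _ _ (OrderDual.ofDual q.1).2 q.2.2
    · intro q q' hq
      exact hmono _ _ _ _ hq.1 hq.2
  have hcell : ∀ p, ∃ j : Fin N, p ∈ J j := by
    intro p
    refine ⟨⟨⌊φ p / η⌋₊, ?_⟩, rfl⟩
    rw [Nat.floor_lt (div_nonneg (hφ0 p) hη.le)]
    exact lt_of_le_of_lt (div_le_div_of_nonneg_right (hφK p) hη.le) hN
  refine ⟨fun o => match o with
    | none => 0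
    | some (j, true) => if h : ∃ p, p ∈ J j ∧ p ∉ I j then h.choose else 0
    | some (j, false) => if h : ∃ p, p ∈ I j ∧ p ≠ 0 then h.choose else 0,
    fun o => match o with
    | none => ∅
    | some (j, true) => ∅
    | some (j, false) => toMeasurable D (EI j), ?_, ?_, ?_⟩
  · rintro (_ | ⟨j, _ | _⟩)
    · exact MeasurableSet.empty
    · exact measurableSet_toMeasurable _ _
    · exact MeasurableSet.empty
  · rintro (_ | ⟨j, _ | _⟩)
    · simp
    · simpa using hEIη j
    · simp
  · intro p
    by_cases hp0 : p = 0
    · exact ⟨none, Or.inl hp0⟩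
    obtain ⟨j, hj⟩ := hcell p
    by_cases hpI : p ∈ I j
    · refine ⟨some (j, false), Or.inr ?_⟩
      have hex : ∃ p, p ∈ I j ∧ p ≠ 0 := ⟨p, hpI, hp0⟩
      simp only [dif_pos hex]
      have hc := hex.choose_spec
      refine ⟨hp0, hc.2, subset_trans ?_ (subset_toMeasurable _ _)⟩
      have h1 : min p hex.choose ∈ I j := by
        rcases min_choice p hex.choose with h | h <;> rw [h]
        exacts [hpI, hc.1]
      have h2 : max p hex.choose ∈ I j := by
        rcases max_choice p hex.choose with h | h <;> rw [h]
        exacts [hpI, hc.1]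
      exact Set.subset_iUnion (fun q : (I j)ᵒᵈ × (I j) =>
        E ((OrderDual.ofDual q.1 : I j) : ℝ) (q.2 : ℝ)) (OrderDual.toDual ⟨_, h1⟩, ⟨_, h2⟩)
    · refine ⟨some (j, true), Or.inl ?_⟩
      have hex : ∃ p, p ∈ J j ∧ p ∉ I j := ⟨p, hj, hpI⟩
      simp only [dif_pos hex]
      have hc := hex.choose_spec
      by_contra hne
      rcases lt_or_gt_of_ne hne with h | h
      · exact hpI ⟨hj, _, hc.1, h⟩
      · exact hc.2 ⟨hc.1, _, hj, h⟩

/-- Difference of the two power sums. -/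
noncomputable def hfun {d : ℕ} (w : Fin d → ℝ) (x : (Fin d → ℝ) × (Fin d → ℝ)) (p : ℝ) : ℝ :=
  ∑ i, w i * x.1 i ^ p - ∑ i, w i * x.2 i ^ p

/-- The box of pairs. -/
def boxx (d : ℕ) (a b : ℝ) : Set ((Fin d → ℝ) × (Fin d → ℝ)) :=
  (Set.univ.pi fun _ => Set.Icc a b) ×ˢ (Set.univ.pi fun _ => Set.Icc a b)

theorem boxx_compact (d : ℕ) (a b : ℝ) : IsCompact (boxx d a b) :=
  (isCompact_univ_pi fun _ => isCompact_Icc).prod (isCompact_univ_pi fun _ => isCompact_Icc)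

theorem boxx_pos {d : ℕ} {a b : ℝ} (ha : 0 < a) {x} (hx : x ∈ boxx d a b) :
    (∀ i, 0 < x.1 i) ∧ (∀ i, 0 < x.2 i) :=
  ⟨fun i => lt_of_lt_of_le ha (hx.1 i trivial).1, fun i => lt_of_lt_of_le ha (hx.2 i trivial).1⟩

theorem hfun_zeros {d : ℕ} (w : Fin d → ℝ) (x : (Fin d → ℝ) × (Fin d → ℝ))
    (h1 : ∀ i, 0 < x.1 i) (h2 : ∀ i, 0 < x.2 i) :
    (∀ p, hfun w x p = 0) ∨ {p | hfun w x p = 0}.encard ≤ (d + d : ℕ) := by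
  have h := expsum_zeros_s10 (d + d) (Fin.append w (fun i => - w i))
    (Fin.append (fun i => Real.log (x.1 i)) (fun i => Real.log (x.2 i)))
  have key : ∀ p, ∑ i, (Fin.append w (fun i => - w i)) i * Real.exp
    ((Fin.append (fun i => Real.log (x.1 i)) (fun i => Real.log (x.2 i))) i * p)
      = hfun w x p := by
    intro p
    rw [Fin.sum_univ_add]
    simp only [Fin.append_left, Fin.append_right, hfun, neg_mul, Finset.sum_neg_distrib,
      Real.rpow_def_of_pos (h1 _), Real.rpow_def_of_pos (h2 _)]
    ring
  simpa only [key] using h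

theorem hfun_contOn {d : ℕ} (w : Fin d → ℝ) {a b : ℝ} (ha : 0 < a) :
    ContinuousOn (fun q : ((Fin d → ℝ) × (Fin d → ℝ)) × ℝ => hfun w q.1 q.2)
      (boxx d a b ×ˢ Set.univ) := by
  unfold hfun
  refine ContinuousOn.sub ?_ ?_
  · refine continuousOn_finsetSum _ fun i _ => continuousOn_const.mul ?_
    refine ContinuousOn.rpow (by fun_prop) (by fun_prop) ?_
    intro q hq
    exact Or.inl ((boxx_pos ha hq.1).1 i).ne'
  · refine continuousOn_finsetSum _ fun i _ => continuousOn_const.mul ?_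
    refine ContinuousOn.rpow (by fun_prop) (by fun_prop) ?_
    intro q hq
    exact Or.inl ((boxx_pos ha hq.1).2 i).ne'

theorem hfun_cont {d : ℕ} (w : Fin d → ℝ) {a b : ℝ} (ha : 0 < a) {x} (hx : x ∈ boxx d a b) :
    Continuous (hfun w x) := by
  rw [← continuousOn_univ]
  exact (hfun_contOn w ha (b := b)).comp (f := fun p : ℝ => (x, p)) (by fun_prop)
    (fun p _ => ⟨hx, trivial⟩)

theorem zeroset_meas {d : ℕ} (w : Fin d → ℝ) {a b : ℝ} (ha : 0 < a) (l r : ℝ) :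
    MeasurableSet {x ∈ boxx d a b | ∃ p ∈ Set.Icc l r, hfun w x p = 0} := by
  have hK : IsCompact (boxx d a b ×ˢ Set.Icc l r) := (boxx_compact d a b).prod isCompact_Icc
  have hc : ContinuousOn (fun q : ((Fin d → ℝ) × (Fin d → ℝ)) × ℝ => hfun w q.1 q.2)
      (boxx d a b ×ˢ Set.Icc l r) :=
    (hfun_contOn w ha).mono (Set.prod_mono le_rfl (Set.subset_univ _))
  have hcl := hc.preimage_isClosed_of_isClosed hK.isClosed (isClosed_singleton (x := (0:ℝ)))
  have hcomp := hK.of_isClosed_subset hcl Set.inter_subset_left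
  have := (hcomp.image continuous_fst).measurableSet
  convert this using 1
  ext x
  simp only [Set.mem_ofPred_eq, Set.mem_image, Set.mem_inter_iff, Set.mem_prod, Set.mem_preimage,
    Set.mem_singleton_iff, Prod.exists, exists_and_right, exists_eq_right]
  constructor
  · rintro ⟨h, p, hp, h0⟩; exact ⟨p, ⟨h, hp⟩, h0⟩
  · rintro ⟨p, ⟨h, hp⟩, h0⟩; exact ⟨h, p, hp, h0⟩

theorem idzero_meas {d : ℕ} (w : Fin d → ℝ) {a b : ℝ} (ha : 0 < a) :
    MeasurableSet {x ∈ boxx d a b | ∀ p, hfun w x p = 0} := by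
  have : {x ∈ boxx d a b | ∀ p, hfun w x p = 0} =
      ⋂ p : ℝ, (boxx d a b ∩ (fun x => hfun w x p) ⁻¹' {0}) := by
    ext x
    simp only [Set.mem_ofPred_eq, Set.mem_iInter, Set.mem_inter_iff, Set.mem_preimage,
      Set.mem_singleton_iff]
    exact ⟨fun h p => ⟨h.1, h.2 p⟩, fun h => ⟨(h 0).1, fun p => (h p).2⟩⟩
  rw [this]
  refine IsClosed.measurableSet (isClosed_iInter fun p => ?_)
  refine ContinuousOn.preimage_isClosed_of_isClosed ?_ (boxx_compact d a b).isClosed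
    isClosed_singleton
  exact (hfun_contOn w ha (b := b)).comp (f := fun x => (x, p)) (by fun_prop)
    (fun x hx => ⟨hx, trivial⟩)

theorem psum_pos {d : ℕ} {w : Fin d → ℝ} (hw : inSimplex w) {u : Fin d → ℝ}
    (hu : ∀ i, 0 < u i) (p : ℝ) : 0 < ∑ i, w i * u i ^ p := by
  have hnn : ∀ i ∈ Finset.univ, 0 ≤ w i * u i ^ p := fun i _ =>
    mul_nonneg (hw.1 i) (Real.rpow_pos_of_pos (hu i) p).le
  rcases (Finset.sum_nonneg hnn).lt_or_eq with h | h
  · exact h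
  · exfalso
    have h0 := (Finset.sum_eq_zero_iff_of_nonneg hnn).1 h.symm
    have : ∑ i, w i = 0 := Finset.sum_eq_zero fun i hi => by
      rcases mul_eq_zero.1 (h0 i hi) with h | h
      · exact h
      · exact absurd h (Real.rpow_pos_of_pos (hu i) p).ne'
    rw [hw.2] at this
    exact one_ne_zero this

theorem pcmp_eq {d : ℕ} {w : Fin d → ℝ} (hw : inSimplex w) {x : (Fin d → ℝ) × (Fin d → ℝ)}
    (h1 : ∀ i, 0 < x.1 i) (h2 : ∀ i, 0 < x.2 i) {p : ℝ} (hp : p ≠ 0) :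
    pcmp x.1 x.2 w p = if 0 ≤ p * hfun w x p then 1 else -1 := by
  have hu := psum_pos hw h1 p
  have hv := psum_pos hw h2 p
  unfold pcmp sgn pmean hfun
  simp only [if_neg hp, Real.log_rpow hu, Real.log_rpow hv]
  have : (0 ≤ 1 / p * Real.log (∑ i, w i * x.1 i ^ p) - 1 / p * Real.log (∑ i, w i * x.2 i ^ p))
      ↔ 0 ≤ p * (∑ i, w i * x.1 i ^ p - ∑ i, w i * x.2 i ^ p) := by
    rw [← mul_sub]
    rcases lt_or_gt_of_ne hp with h | h
    · have h' : 1 / p < 0 := by rw [one_div]; exact inv_lt_zero.2 h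
      have e : ∀ {s t : ℝ}, s < 0 → (0 ≤ s * t ↔ t ≤ 0) := fun {s t} hs =>
        ⟨fun h => by by_contra h2; nlinarith [mul_neg_of_neg_of_pos hs (not_le.1 h2)],
          fun h => mul_nonneg_of_nonpos_of_nonpos hs.le h⟩
      rw [e h', e h, sub_nonpos, sub_nonpos, Real.log_le_log_iff hu hv]
    · have h' : 0 < 1 / p := by positivity
      rw [mul_nonneg_iff_of_pos_left h', mul_nonneg_iff_of_pos_left h, sub_nonneg, sub_nonneg,
        Real.log_le_log_iff hv hu]
  simp only [this]

theorem hfun_zero {d : ℕ} (w : Fin d → ℝ) (x : (Fin d → ℝ) × (Fin d → ℝ)) : hfun w x 0 = 0 := by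
  simp [hfun]

theorem pcmp_const {d : ℕ} {w : Fin d → ℝ} (hw : inSimplex w) {a b : ℝ} (ha : 0 < a)
    {x} (hx : x ∈ boxx d a b) {p q : ℝ} (hp : p ≠ 0) (hq : q ≠ 0) (hpq : p ≤ q)
    (h : (∀ r, hfun w x r = 0) ∨ ∀ r ∈ Set.Icc p q, hfun w x r ≠ 0) :
    pcmp x.1 x.2 w p = pcmp x.1 x.2 w q := by
  have hpos := boxx_pos ha hx
  rw [pcmp_eq hw hpos.1 hpos.2 hp, pcmp_eq hw hpos.1 hpos.2 hq]
  rcases h with h | h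
  · simp [h]
  have hcont : ContinuousOn (fun r => r * hfun w x r) (Set.Icc p q) :=
    (continuous_id.mul (hfun_cont w ha hx)).continuousOn
  have hne : ∀ r ∈ Set.Icc p q, r * hfun w x r ≠ 0 := by
    intro r hr h0
    rcases mul_eq_zero.1 h0 with h1 | h1
    · exact h r hr (by rw [h1, hfun_zero])
    · exact h r hr h1
  have hpre : IsPreconnected (Set.Icc p q) := isPreconnected_Icc
  have hiff : 0 ≤ p * hfun w x p ↔ 0 ≤ q * hfun w x q := by
    constructor
    · intro h1
      by_contra h2
      obtain ⟨r, hr, h0⟩ := hpre.intermediate_value (Set.right_mem_Icc.2 hpq)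
        (Set.left_mem_Icc.2 hpq) hcont ⟨(not_le.1 h2).le, h1⟩
      exact hne r hr h0
    · intro h1
      by_contra h2
      obtain ⟨r, hr, h0⟩ := hpre.intermediate_value (Set.left_mem_Icc.2 hpq)
        (Set.right_mem_Icc.2 hpq) hcont ⟨(not_le.1 h2).le, h1⟩
      exact hne r hr h0
  simp only [hiff]

theorem pmean_meas {d : ℕ} (w : Fin d → ℝ) (p : ℝ) :
    Measurable (fun u : Fin d → ℝ => pmean u w p) := by
  unfold pmean
  split_ifs
  · exact Finset.measurable_prod _ fun i _ => (measurable_pi_apply i).pow_const _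
  · exact (Finset.measurable_sum _ fun i _ =>
      ((measurable_pi_apply i).pow_const _).const_mul _).pow_const _

theorem pcmp_meas {d : ℕ} (w : Fin d → ℝ) (p : ℝ) :
    Measurable (fun x : (Fin d → ℝ) × (Fin d → ℝ) => pcmp x.1 x.2 w p) := by
  unfold pcmp sgn
  refine Measurable.ite (measurableSet_le measurable_const ?_) measurable_const measurable_const
  exact (((pmean_meas w p).comp measurable_fst).log).sub (((pmean_meas w p).comp measurable_snd).log)

theorem pcmp_pm {d : ℕ} (u v w : Fin d → ℝ) (p : ℝ) : pcmp u v w p = 1 ∨ pcmp u v w p = -1 := by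
  unfold pcmp sgn
  split_ifs <;> simp

/-- The expected number of zeros controls the probability of a zero in an interval. -/
theorem phi_exists {d : ℕ} {w : Fin d → ℝ} {a b : ℝ} (ha : 0 < a)
    {Z : Type*} [MeasurableSpace Z] (D : Measure Z) [IsProbabilityMeasure D]
    (X : Z → (Fin d → ℝ) × (Fin d → ℝ)) (hX : Measurable X) :
    ∃ φ : ℝ → ℝ, Monotone φ ∧ (∀ p, 0 ≤ φ p) ∧ (∀ p, φ p ≤ (d + d : ℕ)) ∧
      ∀ l r r', l ≤ r → r < r' →
        D {z | X z ∈ boxx d a b ∧ (¬ ∀ p, hfun w (X z) p = 0) ∧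
          ∃ p ∈ Set.Icc l r, hfun w (X z) p = 0} ≤ ENNReal.ofReal (φ r' - φ l) := by
  classical
  set Q : Z → Prop := fun z => X z ∈ boxx d a b ∧ (¬ ∀ p, hfun w (X z) p = 0) with hQ
  set c : ℝ → Z → ENNReal := fun t z =>
    if Q z then (({p | p < t ∧ hfun w (X z) p = 0}.encard : ℕ∞) : ENNReal) else 0 with hc
  set F : ℝ → ENNReal := fun t => ∫⁻ z, c t z ∂D with hF
  have hcK : ∀ t z, c t z ≤ ((d + d : ℕ) : ENNReal) := by
    intro t z
    simp only [hc]
    split_ifs with h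
    · have hpos := boxx_pos ha h.1
      rcases hfun_zeros w (X z) hpos.1 hpos.2 with h0 | h0
      · exact absurd h0 h.2
      · have : {p | p < t ∧ hfun w (X z) p = 0}.encard ≤ ((d + d : ℕ) : ℕ∞) :=
          (Set.encard_le_encard (fun p hp => hp.2)).trans h0
        have h2 := ENat.toENNReal_le.2 this
        simpa using h2
    · simp
  have hFK : ∀ t, F t ≤ ((d + d : ℕ) : ENNReal) := by
    intro t
    calc F t ≤ ∫⁻ _, ((d + d : ℕ) : ENNReal) ∂D := lintegral_mono (hcK t)
      _ = _ := by simp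
  have hFtop : ∀ t, F t ≠ ⊤ := fun t => ne_top_of_le_ne_top (ENNReal.natCast_ne_top _) (hFK t)
  have hFmono : Monotone F := by
    intro s t hst
    refine lintegral_mono fun z => ?_
    simp only [hc]
    split_ifs with h
    · exact ENat.toENNReal_le.2 (Set.encard_le_encard fun p hp => ⟨lt_of_lt_of_le hp.1 hst, hp.2⟩)
    · exact le_rfl
  refine ⟨fun t => (F t).toReal, fun s t hst => ENNReal.toReal_mono (hFtop t) (hFmono hst),
    fun t => ENNReal.toReal_nonneg, fun t => ?_, ?_⟩
  · have := ENNReal.toReal_mono (ENNReal.natCast_ne_top _) (hFK t)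
    rwa [ENNReal.toReal_natCast] at this
  · intro l r r' hlr hrr'
    set A := {z | X z ∈ boxx d a b ∧ (¬ ∀ p, hfun w (X z) p = 0) ∧
          ∃ p ∈ Set.Icc l r, hfun w (X z) p = 0} with hA
    have hAm : MeasurableSet A := by
      have : A = X ⁻¹' ({x ∈ boxx d a b | ∃ p ∈ Set.Icc l r, hfun w x p = 0} \
          {x ∈ boxx d a b | ∀ p, hfun w x p = 0}) := by
        ext z
        simp only [hA, Set.mem_ofPred_eq, Set.mem_preimage, Set.mem_sdiff]
        tauto
      rw [this]
      exact hX ((zeroset_meas w ha l r).diff (idzero_meas w ha))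
    have hadd : F l + D A ≤ F r' := by
      rw [← lintegral_indicator_one hAm]
      refine (le_lintegral_add _ _).trans (lintegral_mono fun z => ?_)
      simp only [hc]
      by_cases hz : z ∈ A
      · have hQz : Q z := ⟨hz.1, hz.2.1⟩
        rw [if_pos hQz, if_pos hQz, Set.indicator_of_mem hz]
        obtain ⟨p, hp, hp0⟩ := hz.2.2
        have hnot : p ∉ {p | p < l ∧ hfun w (X z) p = 0} := fun h => absurd h.1 (not_lt.2 hp.1)
        have hle : {p | p < l ∧ hfun w (X z) p = 0}.encard + 1 ≤
            {p | p < r' ∧ hfun w (X z) p = 0}.encard := by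
          rw [← Set.encard_insert_of_notMem hnot]
          refine Set.encard_le_encard ?_
          rintro q (rfl | hq)
          · exact ⟨lt_of_le_of_lt hp.2 hrr', hp0⟩
          · exact ⟨by linarith [hq.1], hq.2⟩
        have := ENat.toENNReal_le.2 hle
        simpa using this
      · rw [Set.indicator_of_notMem hz, add_zero]
        split_ifs with h
        · exact ENat.toENNReal_le.2
            (Set.encard_le_encard fun p hp => ⟨by linarith [hp.1], hp.2⟩)
        · exact le_rfl
    rw [← ENNReal.toReal_sub_of_le (hFmono (by linarith)) (hFtop _), ENNReal.ofReal_toReal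
      (ENNReal.sub_ne_top (hFtop _))]
    exact ENNReal.le_sub_of_add_le_left (hFtop _) hadd

theorem numeric_s10 (d : ℕ) (hd : 2 ≤ d) (n : ℕ) (hn : 1 ≤ n) (δ : ℝ) (hδ : 0 < δ) (hδ1 : δ < 1) :
    1 ≤ 2 * (Real.logb 2 d + 1) * Real.log (n + 1) + Real.log (8 / δ) ∧
    (4 * d * n + 3) * (3 * Real.exp (-(2 * (Real.logb 2 d + 1) * Real.log (n + 1)
      + Real.log (8 / δ)))) ≤ δ := by
  have hn1 : (1:ℝ) ≤ n := by exact_mod_cast hn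
  have hd2 : (2:ℝ) ≤ d := by exact_mod_cast hd
  have hl2 : 0 < Real.log 2 := Real.log_pos (by norm_num)
  have hld : 0 < Real.log d := Real.log_pos (by linarith)
  have hln : Real.log 2 ≤ Real.log (n + 1) := Real.log_le_log (by norm_num) (by linarith)
  have hlb : Real.log d ≤ Real.logb 2 d * Real.log (n + 1) := by
    rw [Real.logb, div_mul_eq_mul_div, le_div_iff₀ hl2]
    exact mul_le_mul_of_nonneg_left hln hld.le
  have h8 : 1 ≤ Real.log (8 / δ) := by
    rw [Real.le_log_iff_exp_le (by positivity)]
    have : (8:ℝ) ≤ 8 / δ := by rw [le_div_iff₀ hδ]; linarith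
    linarith [Real.exp_one_lt_d9]
  have hmain : 2 * Real.log d + 2 * Real.log (n + 1) ≤
      2 * (Real.logb 2 d + 1) * Real.log (n + 1) := by nlinarith
  refine ⟨by linarith, ?_⟩
  have hexp : Real.exp (-(2 * (Real.logb 2 d + 1) * Real.log (n + 1)
      + Real.log (8 / δ))) ≤ δ / 8 / ((d:ℝ) ^ 2 * (n + 1) ^ 2) := by
    calc _ ≤ Real.exp (-(2 * Real.log d + 2 * Real.log (n + 1) + Real.log (8 / δ))) :=
          Real.exp_le_exp.2 (by linarith)
      _ = Real.exp (Real.log (δ / 8 / ((d:ℝ) ^ 2 * (n + 1) ^ 2))) := by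
          congr 1
          rw [Real.log_div (x := δ / 8) (by positivity) (by positivity),
            Real.log_mul (by positivity) (by positivity), Real.log_pow, Real.log_pow,
            Real.log_div (by norm_num) hδ.ne', Real.log_div hδ.ne' (by norm_num)]
          push_cast
          ring
      _ = _ := Real.exp_log (by positivity)
  calc _ ≤ (4 * (d:ℝ) * n + 3) * (3 * (δ / 8 / ((d:ℝ) ^ 2 * (n + 1) ^ 2))) := by gcongr
    _ = δ * ((3 * (4 * d * n + 3)) / (8 * ((d:ℝ) ^ 2 * (n + 1) ^ 2))) := by
        field_simp
    _ ≤ δ * 1 := by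
        gcongr
        rw [div_le_one (by positivity)]
        have e1 : 2 * (d:ℝ) ≤ d ^ 2 := by nlinarith
        have e2 : 4 * (n:ℝ) ≤ (n + 1) ^ 2 := by nlinarith [sq_nonneg ((n:ℝ) - 1)]
        have e3 : 2 * (d:ℝ) * (4 * n) ≤ d ^ 2 * (n + 1) ^ 2 := by gcongr
        nlinarith [mul_le_mul hd2 hn1 (by norm_num) (by linarith)]
    _ = δ := mul_one δ

/-- PAC bound for learning a power mean with known weights from noiseless
pairwise comparisons under the 0-1 loss. -/
theorem comparison_pac_known_weights (d : ℕ) (hd : 2 ≤ d)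
    (umin umax : ℝ) (hmin : 0 < umin) (hle : umin ≤ umax)
    (w : Fin d → ℝ) (hw : inSimplex w)
    (D : Measure (((Fin d → ℝ) × (Fin d → ℝ)) × ℝ)) [IsProbabilityMeasure D]
    (hsupp : D {z | (∀ i, z.1.1 i ∈ Set.Icc umin umax) ∧
        (∀ i, z.1.2 i ∈ Set.Icc umin umax) ∧ (z.2 = 1 ∨ z.2 = -1)} = 1)
    (n : ℕ) (hn : 1 ≤ n) (δ : ℝ) (hδ : 0 < δ)
    (phat : (Fin n → ((Fin d → ℝ) × (Fin d → ℝ)) × ℝ) → ℝ)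
    (herm : ∀ s : Fin n → ((Fin d → ℝ) × (Fin d → ℝ)) × ℝ,
      (1 / n : ℝ) * ∑ i, (1 + (s i).2 * pcmp (s i).1.1 (s i).1.2 w (phat s)) / 2
        = ⨅ p : ℝ, (1 / n : ℝ) * ∑ i, (1 + (s i).2 * pcmp (s i).1.1 (s i).1.2 w p) / 2) :
    (Measure.pi fun _ : Fin n => D)
        {s | (∫ z, (1 + z.2 * pcmp z.1.1 z.1.2 w (phat s)) / 2 ∂D)
              - (⨅ p : ℝ, ∫ z, (1 + z.2 * pcmp z.1.1 z.1.2 w p) / 2 ∂D)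
            ≤ 16 * Real.sqrt ((2 * (Real.logb 2 d + 1) * Real.log (n + 1)
                + Real.log (8 / δ)) / n)}
      ≥ ENNReal.ofReal (1 - δ) := by
  classical
  have hn0 : (0:ℝ) < n := by exact_mod_cast hn
  have hn1 : (1:ℝ) ≤ n := by exact_mod_cast hn
  have hd2 : (2:ℝ) ≤ d := by exact_mod_cast hd
  rcases le_or_gt 1 δ with hδ1 | hδ1
  · rw [ENNReal.ofReal_of_nonpos (by linarith)]
    exact zero_le
  set μ := (Measure.pi fun _ : Fin n => D) with hμ
  set L : ℝ := 2 * (Real.logb 2 d + 1) * Real.log (n + 1) + Real.log (8 / δ) with hL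
  obtain ⟨hL1, hLexp⟩ := numeric_s10 d hd n hn δ hδ hδ1
  rw [← hL] at hL1 hLexp
  set ε : ℝ := Real.sqrt (L / n) with hε
  have hεsq : ε ^ 2 = L / n := Real.sq_sqrt (by positivity)
  have hεn : 1 / (n:ℝ) ≤ ε := by
    apply Real.le_sqrt_of_sq_le
    rw [div_pow, one_pow]
    rw [div_le_div_iff₀ (by positivity) hn0]
    nlinarith
  have hε0 : 0 < ε := lt_of_lt_of_le (by positivity) hεn
  set G : Set (((Fin d → ℝ) × (Fin d → ℝ)) × ℝ) :=
    {z | (∀ i, z.1.1 i ∈ Set.Icc umin umax) ∧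
        (∀ i, z.1.2 i ∈ Set.Icc umin umax) ∧ (z.2 = 1 ∨ z.2 = -1)} with hG
  have hGeq : G = (Prod.fst ⁻¹' boxx d umin umax) ∩ (Prod.snd ⁻¹' {1, -1}) := by
    ext z
    simp only [hG, boxx, Set.mem_ofPred_eq, Set.mem_inter_iff, Set.mem_preimage, Set.mem_prod,
      Set.mem_pi, Set.mem_univ, true_imp_iff, Set.mem_insert_iff, Set.mem_singleton_iff]
    tauto
  have hGm : MeasurableSet G := by
    rw [hGeq]
    exact (measurable_fst (boxx_compact d umin umax).measurableSet).inter
      (measurable_snd ((Set.finite_singleton (-1:ℝ)).insert 1).measurableSet)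
  have hGbox : ∀ z ∈ G, z.1 ∈ boxx d umin umax := by
    intro z hz; rw [hGeq] at hz; exact hz.1
  have hGae : ∀ᵐ z ∂D, z ∈ G := (mem_ae_iff_prob_eq_one hGm).2 hsupp
  set g : ℝ → ((Fin d → ℝ) × (Fin d → ℝ)) × ℝ → ℝ :=
    fun p z => (1 + z.2 * pcmp z.1.1 z.1.2 w p) / 2 with hg
  set f : ℝ → ((Fin d → ℝ) × (Fin d → ℝ)) × ℝ → ℝ := fun p => G.indicator (g p) with hf
  have hgm : ∀ p, Measurable (g p) := fun p =>
    ((measurable_snd.mul ((pcmp_meas w p).comp measurable_fst)).const_add 1).div_const 2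
  have hfm : ∀ p, Measurable (f p) := fun p => (hgm p).indicator hGm
  have hg01 : ∀ p, ∀ z ∈ G, g p z ∈ Set.Icc (0:ℝ) 1 := by
    intro p z hz
    simp only [hg]
    rcases hz.2.2 with h | h <;> rcases pcmp_pm z.1.1 z.1.2 w p with h' | h' <;>
      rw [h, h'] <;> norm_num
  have hf01 : ∀ p z, f p z ∈ Set.Icc (0:ℝ) 1 := by
    intro p z
    by_cases hz : z ∈ G
    · simp only [hf, Set.indicator_of_mem hz]; exact hg01 p z hz
    · simp [hf, hz]
  have hfg : ∀ p, ∫ z, f p z ∂D = ∫ z, g p z ∂D := fun p =>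
    integral_congr_ae (hGae.mono fun z hz => by simp only [hf, Set.indicator_of_mem hz])
  obtain ⟨φ, hφm, hφ0, hφK, hφE⟩ := phi_exists (w := w) (b := umax) hmin D Prod.fst measurable_fst
  obtain ⟨c, B, hBm, hBη, hcov⟩ := cells D φ hφm (d + d : ℕ) (2 * ε) hφ0 hφK (by positivity)
    (fun l r => {z | z.1 ∈ boxx d umin umax ∧ (¬ ∀ p, hfun w z.1 p = 0) ∧
          ∃ p ∈ Set.Icc l r, hfun w z.1 p = 0})
    (by
      rintro a b a' b' haa hbb z ⟨h1, h2, p, hp, h3⟩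
      exact ⟨h1, h2, p, ⟨haa.trans hp.1, hp.2.trans hbb⟩, h3⟩)
    hφE (2 * d * n + 1) (by
      rw [div_lt_iff₀ (by positivity)]
      push_cast
      have : 1 ≤ ε * n := by rwa [div_le_iff₀ hn0] at hεn
      nlinarith)
  have hconc := bracket D n hn f hfm hf01 (2 * ε) (2 * ε) (by positivity) (by positivity) c B
    hBm hBη (by
      intro p
      obtain ⟨i, hi⟩ := hcov p
      refine ⟨i, fun z hz => ?_⟩
      rcases hi with rfl | ⟨hp0, hc0, hsub⟩
      · rfl
      by_cases hzG : z ∈ G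
      swap
      · simp [hf, hzG]
      simp only [hf, Set.indicator_of_mem hzG, hg]
      have hnz : z ∉ {z : ((Fin d → ℝ) × (Fin d → ℝ)) × ℝ | z.1 ∈ boxx d umin umax ∧
          (¬ ∀ p, hfun w z.1 p = 0) ∧
          ∃ q ∈ Set.Icc (min p (c i)) (max p (c i)), hfun w z.1 q = 0} := fun h => hz (hsub h)
      have hcase : (∀ r, hfun w z.1 r = 0) ∨
          ∀ r ∈ Set.Icc (min p (c i)) (max p (c i)), hfun w z.1 r ≠ 0 := by
        by_contra hcon
        push Not at hcon
        obtain ⟨⟨r, hr⟩, q, hq, hq0⟩ := hcon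
        exact hnz ⟨hGbox z hzG, fun h => hr (h r), q, hq, hq0⟩
      have : pcmp z.1.1 z.1.2 w p = pcmp z.1.1 z.1.2 w (c i) := by
        rcases le_total p (c i) with h | h
        · rw [min_eq_left h, max_eq_right h] at hcase
          exact pcmp_const hw hmin (hGbox z hzG) hp0 hc0 h hcase
        · rw [min_eq_right h, max_eq_left h] at hcase
          exact (pcmp_const hw hmin (hGbox z hzG) hc0 hp0 h hcase).symm
      rw [this])
  rw [← hμ] at hconc
  set Bad := {s : Fin n → ((Fin d → ℝ) × (Fin d → ℝ)) × ℝ |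
    ∃ p, 2 * (2 * ε) + 2 * (2 * ε) < |(1 / n : ℝ) * ∑ i, f p (s i) - ∫ z, f p z ∂D|} with hBad
  have hBadδ : μ Bad ≤ ENNReal.ofReal δ := by
    refine hconc.trans ?_
    have hexp : Real.exp (-2 * n * (2 * ε) ^ 2) ≤ Real.exp (-L) := by
      apply Real.exp_le_exp.2
      rw [mul_pow, hεsq]
      have : -2 * (n:ℝ) * (2 ^ 2 * (L / n)) = -8 * L := by field_simp; ring
      rw [this]
      linarith
    calc ((Fintype.card (Option (Fin (2 * d * n + 1) × Bool)) : ℕ) : ENNReal) *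
          (3 * ENNReal.ofReal (Real.exp (-2 * n * (2 * ε) ^ 2)))
        ≤ ENNReal.ofReal (4 * d * n + 3) * (ENNReal.ofReal 3 * ENNReal.ofReal (Real.exp (-L))) := by
          gcongr
          · rw [← ENNReal.ofReal_natCast]
            apply ENNReal.ofReal_le_ofReal
            simp only [Fintype.card_option, Fintype.card_prod, Fintype.card_fin, Fintype.card_bool]
            push_cast
            linarith
          · simp
      _ = ENNReal.ofReal ((4 * d * n + 3) * (3 * Real.exp (-L))) := by
          rw [← ENNReal.ofReal_mul (by norm_num), ← ENNReal.ofReal_mul (by positivity)]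
      _ ≤ ENNReal.ofReal δ := ENNReal.ofReal_le_ofReal hLexp
  have hGs : ∀ᵐ s ∂μ, ∀ i, s i ∈ G := by
    rw [ae_all_iff]
    intro i
    exact (measurePreserving_eval (fun _ : Fin n => D) i).quasiMeasurePreserving.ae hGae
  set T := {s : Fin n → ((Fin d → ℝ) × (Fin d → ℝ)) × ℝ | (∫ z, g (phat s) z ∂D)
              - (⨅ p : ℝ, ∫ z, g p z ∂D) ≤ 16 * ε} with hT
  have hTsub : ∀ s, (∀ i, s i ∈ G) → s ∉ Bad → s ∈ T := by
    intro s hs hb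
    simp only [hBad, Set.mem_ofPred_eq, not_exists, not_lt] at hb
    have hemp : ∀ p, (1 / n : ℝ) * ∑ i, f p (s i) = (1 / n : ℝ) * ∑ i, g p (s i) := by
      intro p
      congr 1
      exact Finset.sum_congr rfl fun i _ => by simp only [hf, Set.indicator_of_mem (hs i)]
    simp only [hemp, hfg] at hb
    have hbdd : BddBelow (Set.range fun p : ℝ => (1 / n : ℝ) * ∑ i, g p (s i)) := by
      refine ⟨0, ?_⟩
      rintro _ ⟨p, rfl⟩
      exact mul_nonneg (by positivity) (Finset.sum_nonneg fun i _ => (hg01 p _ (hs i)).1)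
    have hle : ∀ q, (∫ z, g (phat s) z ∂D) - 16 * ε ≤ ∫ z, g q z ∂D := by
      intro q
      have h1 := abs_le.1 (hb (phat s))
      have h2 := abs_le.1 (hb q)
      have h3 : (1 / n : ℝ) * ∑ i, g (phat s) (s i) ≤ (1 / n : ℝ) * ∑ i, g q (s i) :=
        (le_of_eq (herm s)).trans (ciInf_le hbdd q)
      linarith [h1.1, h1.2, h2.1, h2.2]
    have := le_ciInf hle
    simp only [hT, Set.mem_ofPred_eq]
    linarith
  have hcompl : μ Tᶜ ≤ ENNReal.ofReal δ := by
    refine le_trans (measure_mono_ae ?_) hBadδ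
    filter_upwards [hGs] with s hs hsT
    by_contra hb
    exact hsT (hTsub s hs hb)
  have h1 : (1:ENNReal) ≤ μ T + μ Tᶜ := by
    have := measure_union_le (μ := μ) T Tᶜ
    rwa [Set.union_compl_self, measure_univ] at this
  change ENNReal.ofReal (1 - δ) ≤ μ T
  rw [ENNReal.ofReal_sub _ hδ.le, ENNReal.ofReal_one, tsub_le_iff_right]
  exact h1.trans (by gcongr)
end
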